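/- For every C > 0 there is a constant C' such that the following holds for all real additive functions f for which the series Σ_p min(1, f(p)²)/p and Σ_{p : |f(p)|≤1} f(p)/p converge, all R ≥ 3, T ≥ 3, x ≥ 3, and all ε with 1/√(log x) < ε ≤ 1/2 satisfying 2·log₂R + (1/2)·T²·η_f(R) + 7 ≤ (1/4)·log(1/ε) and T²·η_f(x^ε) ≤ C·ε^{1/3}: for every τ with |τ| ≤ T, |φ_x(τ; R) − φ(τ; R)| ≤ C'·ε^{1/6}, where φ_x(τ; R) := (1/x)·Σ_{n ≤ x} e^{iτ f_R(n)} and φ(τ; R) := ∏_p (1 − 1/p)·Σ_{ν≥0} e^{iτ f_R(p^ν)}/p^ν. -/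

import Mathlib

open Filter Topology Finset MeasureTheory
open scoped Classical

noncomputable section

/-- A real additive arithmetic function. -/
def IsAdditive (f : ℕ → ℝ) : Prop :=
  ∀ m n : ℕ, 0 < m → 0 < n → Nat.Coprime m n → f (m * n) = f m + f n

/-- A real strongly additive arithmetic function. -/
def IsStronglyAdditive (f : ℕ → ℝ) : Prop :=
  IsAdditive f ∧ ∀ p ν : ℕ, p.Prime → 1 ≤ ν → f (p ^ ν) = f p

/-- Convergence of the two Erdős–Wintner series. -/
def EWConv (f : ℕ → ℝ) : Prop :=
  Summable (fun p : Nat.Primes => min 1 (f p ^ 2) / (p : ℝ)) ∧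
  ∃ ℓ : ℝ, Tendsto (fun N : ℕ =>
      ∑ p ∈ (Finset.range N).filter (fun p => Nat.Prime p ∧ |f p| ≤ 1), f p / (p : ℝ))
    atTop (𝓝 ℓ)

/-- The series over primes with f(p) ≠ 0 of 1/p. -/
def DivergentCase (f : ℕ → ℝ) : Prop :=
  ¬ Summable (fun p : Nat.Primes => if f (p : ℕ) ≠ 0 then (1 : ℝ) / (p : ℕ) else 0)

def EtaBound (f : ℕ → ℝ) (η : ℝ → ℝ) : Prop :=
  Continuous η ∧ Antitone η ∧ Tendsto η atTop (𝓝 0) ∧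
  (∀ y : ℝ, 1 ≤ y → ∃ ℓ : ℝ,
    Tendsto (fun N : ℕ =>
        ∑ p ∈ (Finset.range N).filter (fun p => Nat.Prime p ∧ y < (p : ℝ) ∧ |f p| ≤ 1),
          f p / (p : ℝ)) atTop (𝓝 ℓ) ∧ |ℓ| ≤ η y) ∧
  (∀ y : ℝ, 1 ≤ y →
    (∑' n : ℕ, if IsPrimePow n ∧ y < (n : ℝ) then min 1 (f n ^ 2) / (n : ℝ) else 0) ≤ η y)

/-- The truncated additive function f_R. -/
def fR (f : ℕ → ℝ) (R : ℝ) (n : ℕ) : ℝ :=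
  ∑ p ∈ n.primeFactors,
    (if ((p ^ (n.factorization p) : ℕ) : ℝ) ≤ R ∨ |f (p ^ (n.factorization p))| ≤ 1
      then f (p ^ (n.factorization p)) else 0)

/-- B_f(v) := sqrt(2 + Σ_{p^ν ≤ v} f(p^ν)²/p^ν). -/
def Bf (f : ℕ → ℝ) (v : ℝ) : ℝ :=
  Real.sqrt (2 + ∑ n ∈ (Finset.Icc 2 ⌊v⌋₊).filter IsPrimePow, f n ^ 2 / (n : ℝ))

/-- π_k(x) = #{n ≤ x : ω(n) = k}. -/
def pik (x : ℝ) (k : ℕ) : ℕ :=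
  ((Finset.Icc 1 ⌊x⌋₊).filter (fun n => n.primeFactors.card = k)).card

/-- The empirical distribution function. -/
def Fx (f : ℕ → ℝ) (x : ℝ) (y : ℝ) : ℝ :=
  (((Finset.Icc 1 ⌊x⌋₊).filter (fun n => f n ≤ y)).card : ℝ) / x

def uf (f : ℕ → ℝ) (m : ℕ) : ℝ :=
  if ∀ p ∈ m.primeFactors, f (p ^ (m.factorization p)) ≠ 0 then 1 else 0

def vf (f : ℕ → ℝ) (d : ℕ) : ℝ :=
  if ∀ p ∈ d.primeFactors, f (p ^ (d.factorization p)) = 0 then 1 else 0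

def wp (f : ℕ → ℝ) (p : ℕ) : ℝ :=
  (1 - 1 / (p : ℝ)) * ∑' ν : ℕ, uf f (p ^ (ν + 1)) / (p : ℝ) ^ (ν + 1)

def hf (f : ℕ → ℝ) (m : ℕ) : ℝ :=
  uf f m * ∏ p ∈ m.primeFactors, (1 - 1 / (p : ℝ)) / (1 - wp f p)

def alphaf (f : ℕ → ℝ) (y : ℝ) : ℝ :=
  ∑' p : Nat.Primes, if y < ((p : ℕ) : ℝ) then uf f (p : ℕ) / ((p : ℕ) : ℝ) else 0

def betaf (f : ℕ → ℝ) (y : ℝ) : ℝ :=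
  (1 / Real.log y) * ∫ t in (1:ℝ)..y, alphaf f t / t

def Flim (f : ℕ → ℝ) (y : ℝ) : ℝ :=
  (∏' p : Nat.Primes, (1 - wp f (p : ℕ))) *
    ∑' m : ℕ, if 1 ≤ m ∧ f m ≤ y then hf f m / m else 0


theorem aux_count (X : ℝ) (L : ℕ) (hX : 0 ≤ X) (hL : 0 < L) :
    |(∑ n ∈ Finset.Icc 1 ⌊X⌋₊, if L ∣ n then (1:ℝ) else 0) - X / L| ≤ 1 := by
  have h1 : (∑ n ∈ Finset.Icc 1 ⌊X⌋₊, if L ∣ n then (1:ℝ) else 0) = ((⌊X / L⌋₊ : ℕ) : ℝ) := by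
    rw [Nat.floor_div_natCast, ← Nat.Ioc_filter_dvd_card_eq_div, Finset.sum_ite]
    simp only [Finset.sum_const_zero, add_zero, Finset.sum_const, nsmul_eq_mul, mul_one]
    congr 2
  rw [h1]
  have h2 : (0:ℝ) ≤ X / L := by positivity
  have h3 := Nat.floor_le h2
  have h4 := Nat.lt_floor_add_one (X / L)
  rw [abs_le]; constructor <;> linarith

theorem aux_count_le (N : ℕ) (L : ℕ) :
    (∑ n ∈ Finset.Icc 1 N, if L ∣ n then (1:ℝ) else 0) ≤ N / L := by
  have h1 : (∑ n ∈ Finset.Icc 1 N, if L ∣ n then (1:ℝ) else 0) = ((N / L : ℕ) : ℝ) := by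
    rw [← Nat.Ioc_filter_dvd_card_eq_div, Finset.sum_ite]
    simp only [Finset.sum_const_zero, add_zero, Finset.sum_const, nsmul_eq_mul, mul_one]
    congr 2
  rw [h1]
  exact Nat.cast_div_le

theorem aux_log_primes (n : ℕ) (hn : n ≠ 0) :
    ∑ p ∈ n.primeFactors, Real.log p ≤ Real.log n := by
  rw [← Real.log_prod (fun p hp => by
    have := (Nat.prime_of_mem_primeFactors hp).pos
    positivity)]
  apply Real.log_le_log
  · apply Finset.prod_pos
    intro p hp
    have := (Nat.prime_of_mem_primeFactors hp).pos
    positivity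
  · have := Nat.le_of_dvd (Nat.pos_of_ne_zero hn) (Nat.prod_primeFactors_dvd n)
    calc (∏ p ∈ n.primeFactors, (p:ℝ)) = ((∏ p ∈ n.primeFactors, p : ℕ) : ℝ) := by push_cast; rfl
      _ ≤ n := by exact_mod_cast this

theorem aux_mertens (N : ℕ) (hN : 1 ≤ N) :
    ∑ p ∈ (N+1).primesBelow, Real.log p / p ≤ 2 * Real.log N := by
  have hNpos : (0:ℝ) < N := by exact_mod_cast hN
  have h1 : ∑ n ∈ Finset.Icc 1 N, ∑ p ∈ n.primeFactors, Real.log p ≤ N * Real.log N := by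
    calc _ ≤ ∑ n ∈ Finset.Icc 1 N, Real.log N := by
          apply Finset.sum_le_sum
          intro n hn
          rw [Finset.mem_Icc] at hn
          refine (aux_log_primes n (by lia)).trans ?_
          apply Real.log_le_log
          · have := hn.1; positivity
          · exact_mod_cast hn.2
      _ = N * Real.log N := by simp
  have h2 : ∑ n ∈ Finset.Icc 1 N, ∑ p ∈ n.primeFactors, Real.log p
      = ∑ p ∈ (N+1).primesBelow, ∑ n ∈ Finset.Icc 1 N, if p ∣ n then Real.log p else 0 := by
    rw [Finset.sum_comm]
    apply Finset.sum_congr rfl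
    intro n hn
    rw [Finset.mem_Icc] at hn
    rw [← Finset.sum_filter]
    apply Finset.sum_congr _ (fun _ _ => rfl)
    ext p
    simp only [Nat.mem_primeFactors, Finset.mem_filter, Nat.mem_primesBelow]
    constructor
    · rintro ⟨hp, hd, h0⟩
      have := Nat.le_of_dvd (by lia) hd
      exact ⟨⟨by lia, hp⟩, hd⟩
    · rintro ⟨⟨_, hp⟩, hd⟩
      exact ⟨hp, hd, by lia⟩
  have h3 : ∀ p ∈ (N+1).primesBelow, (N:ℝ)/2 * (Real.log p / p) ≤
      ∑ n ∈ Finset.Icc 1 N, if p ∣ n then Real.log p else 0 := by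
    intro p hp
    rw [Nat.mem_primesBelow] at hp
    have hp0 : 0 < p := hp.2.pos
    have hlog : 0 ≤ Real.log p := Real.log_natCast_nonneg p
    have hc := aux_count N p hNpos.le hp0
    rw [Nat.floor_natCast] at hc
    have h1' : (1:ℝ) ≤ ∑ n ∈ Finset.Icc 1 N, if p ∣ n then (1:ℝ) else 0 := by
      have hm : p ∈ Finset.Icc 1 N := by rw [Finset.mem_Icc]; lia
      have := Finset.single_le_sum (f := fun n => if p ∣ n then (1:ℝ) else 0)
        (fun i _ => by positivity) hm
      simpa using this
    have h2' : (N:ℝ)/p/2 ≤ ∑ n ∈ Finset.Icc 1 N, if p ∣ n then (1:ℝ) else 0 := by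
      rw [abs_le] at hc; linarith
    calc (N:ℝ)/2 * (Real.log p / p) = ((N:ℝ)/p/2) * Real.log p := by ring
      _ ≤ (∑ n ∈ Finset.Icc 1 N, if p ∣ n then (1:ℝ) else 0) * Real.log p := by gcongr
      _ = _ := by
        rw [Finset.sum_mul]; apply Finset.sum_congr rfl; intro n _; split_ifs <;> simp
  have h4 : (N:ℝ)/2 * ∑ p ∈ (N+1).primesBelow, Real.log p / p ≤ N * Real.log N := by
    rw [Finset.mul_sum]
    exact (Finset.sum_le_sum h3).trans (h2 ▸ h1)
  have h5 : (N:ℝ)/2 * ∑ p ∈ (N+1).primesBelow, Real.log p / p ≤ (N:ℝ)/2 * (2 * Real.log N) := by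
    linarith
  exact le_of_mul_le_mul_left h5 (by positivity)

theorem aux_bracket (q e : ℕ) (hq : 0 < q) :
    ∑ d ∈ q.divisors, (if e ∣ d then (ArithmeticFunction.moebius (q/d) : ℝ) else 0)
      = if e = q then 1 else 0 := by
  by_cases he : e ∣ q
  · obtain ⟨m, rfl⟩ := he
    have he0 : 0 < e := Nat.pos_of_mul_pos_right hq
    have hm0 : 0 < m := Nat.pos_of_mul_pos_left hq
    have h1 : ∑ d ∈ (e*m).divisors, (if e ∣ d then (ArithmeticFunction.moebius ((e*m)/d) : ℝ) else 0)
      = ∑ d ∈ m.divisors, (ArithmeticFunction.moebius (m/d) : ℝ) := by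
      rw [← Finset.sum_filter]
      symm
      apply Finset.sum_bij (fun d _ => e * d)
      · intro d hd
        rw [Nat.mem_divisors] at hd
        rw [Finset.mem_filter, Nat.mem_divisors]
        exact ⟨⟨Nat.mul_dvd_mul_left e hd.1, by positivity⟩, Dvd.intro _ rfl⟩
      · intro a _ b _ hab
        exact Nat.eq_of_mul_eq_mul_left he0 hab
      · intro b hb
        rw [Finset.mem_filter, Nat.mem_divisors] at hb
        obtain ⟨⟨h1, h2⟩, c, rfl⟩ := hb
        exact ⟨c, by rw [Nat.mem_divisors]; exact ⟨Nat.dvd_of_mul_dvd_mul_left he0 h1, by lia⟩, rfl⟩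
      · intro d hd
        rw [Nat.mul_div_mul_left _ _ he0]
    rw [h1, Nat.sum_div_divisors (α := ℝ) m (fun d => (ArithmeticFunction.moebius d : ℝ))]
    have h2 := ArithmeticFunction.coe_mul_zeta_apply (R := ℤ) (f := ArithmeticFunction.moebius) (x := m)
    rw [ArithmeticFunction.moebius_mul_coe_zeta, ArithmeticFunction.one_apply] at h2
    have h3 : (∑ d ∈ m.divisors, (ArithmeticFunction.moebius d : ℝ)) = if m = 1 then 1 else 0 := by
      rw [← Int.cast_sum, ← h2]; push_cast; rfl
    rw [h3]
    congr 1
    apply propext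
    constructor
    · rintro rfl; simp
    · intro h
      have : e * m = e * 1 := by lia
      exact Nat.eq_of_mul_eq_mul_left he0 this
  · rw [if_neg (by rintro rfl; exact he dvd_rfl)]
    apply Finset.sum_eq_zero
    intro d hd
    rw [if_neg]
    intro hed
    exact he (hed.trans (Nat.dvd_of_mem_divisors hd))

def ram (q n : ℕ) : ℝ :=
  ∑ d ∈ q.divisors, if d ∣ n then (d:ℝ) * (ArithmeticFunction.moebius (q/d) : ℝ) else 0

theorem ram_main (q q' : ℕ) (hq : 0 < q) (hq' : 0 < q') :
    ∑ d ∈ q.divisors, ∑ d' ∈ q'.divisors, (Nat.gcd d d' : ℝ) *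
      ((ArithmeticFunction.moebius (q/d) : ℝ) * (ArithmeticFunction.moebius (q'/d') : ℝ))
      = if q = q' then (Nat.totient q : ℝ) else 0 := by
  have h1 : ∀ d ∈ q.divisors, ∀ d' ∈ q'.divisors, (Nat.gcd d d' : ℝ)
      = ∑ e ∈ q.divisors, (if e ∣ d then (1:ℝ) else 0) * (if e ∣ d' then (1:ℝ) else 0)
          * Nat.totient e := by
    intro d hd d' hd'
    have hd0 : 0 < d := Nat.pos_of_mem_divisors hd
    have h := Nat.sum_totient (Nat.gcd d d')
    calc (Nat.gcd d d' : ℝ) = ((∑ e ∈ (Nat.gcd d d').divisors, Nat.totient e : ℕ) : ℝ) := by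
            rw [h]
      _ = ∑ e ∈ (Nat.gcd d d').divisors, (Nat.totient e : ℝ) := by push_cast; rfl
      _ = ∑ e ∈ q.divisors.filter (fun e => e ∣ d ∧ e ∣ d'), (Nat.totient e : ℝ) := by
          apply Finset.sum_congr _ (fun _ _ => rfl)
          ext e
          rw [Finset.mem_filter, Nat.mem_divisors, Nat.mem_divisors, Nat.dvd_gcd_iff]
          have hg : Nat.gcd d d' ≠ 0 := (Nat.gcd_pos_of_pos_left _ hd0).ne'
          constructor
          · rintro ⟨h, _⟩
            exact ⟨⟨h.1.trans (Nat.dvd_of_mem_divisors hd), hq.ne'⟩, h⟩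
          · rintro ⟨_, h⟩; exact ⟨h, hg⟩
      _ = _ := by
          rw [Finset.sum_filter]
          apply Finset.sum_congr rfl
          intro e _
          by_cases ha : e ∣ d <;> by_cases hb : e ∣ d' <;> simp [ha, hb]
  have h2 : ∑ d ∈ q.divisors, ∑ d' ∈ q'.divisors, (Nat.gcd d d' : ℝ) *
      ((ArithmeticFunction.moebius (q/d) : ℝ) * (ArithmeticFunction.moebius (q'/d') : ℝ))
      = ∑ e ∈ q.divisors, (Nat.totient e : ℝ) *
        ((∑ d ∈ q.divisors, (if e ∣ d then (ArithmeticFunction.moebius (q/d) : ℝ) else 0)) *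
         (∑ d ∈ q'.divisors, (if e ∣ d then (ArithmeticFunction.moebius (q'/d) : ℝ) else 0))) := by
    simp_rw [Finset.sum_mul_sum, Finset.mul_sum]
    rw [Finset.sum_comm (s := q.divisors) (t := q.divisors)]
    apply Finset.sum_congr rfl
    intro d hd
    rw [Finset.sum_comm]
    apply Finset.sum_congr rfl
    intro d' hd'
    rw [h1 d hd d' hd', Finset.sum_mul]
    apply Finset.sum_congr rfl
    intro e _
    by_cases ha : e ∣ d <;> by_cases hb : e ∣ d' <;> simp [ha, hb]
  rw [h2]
  simp_rw [aux_bracket q _ hq, aux_bracket q' _ hq']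
  rw [Finset.sum_eq_single q]
  · by_cases h : q = q' <;> simp [h]
  · intro b _ hb; simp [hb]
  · intro h; exact absurd (Nat.mem_divisors_self q hq.ne') h

theorem mu_abs_le (n : ℕ) : |(ArithmeticFunction.moebius n : ℝ)| ≤ 1 := by
  have := ArithmeticFunction.abs_moebius_le_one (n := n)
  rw [← Int.cast_abs]
  exact_mod_cast this

theorem sum_div_le (q : ℕ) : ∑ d ∈ q.divisors, (d:ℝ) ≤ (q:ℝ)^2 := by
  calc ∑ d ∈ q.divisors, (d:ℝ) ≤ ∑ d ∈ q.divisors, (q:ℝ) := by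
        apply Finset.sum_le_sum; intro d hd; exact_mod_cast Nat.divisor_le hd
    _ = (q.divisors.card : ℝ) * q := by simp
    _ ≤ q * q := by gcongr; exact Nat.card_divisors_le_self q
    _ = _ := by ring

theorem ram_orth (X : ℝ) (hX : 0 ≤ X) (q q' : ℕ) (hq : 0 < q) (hq' : 0 < q') :
    |(∑ n ∈ Finset.Icc 1 ⌊X⌋₊, ram q n * ram q' n) -
      X * (if q = q' then (Nat.totient q : ℝ) else 0)| ≤ (q:ℝ)^2 * (q':ℝ)^2 := by
  have h1 : (∑ n ∈ Finset.Icc 1 ⌊X⌋₊, ram q n * ram q' n)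
      = ∑ d ∈ q.divisors, ∑ d' ∈ q'.divisors, ((d:ℝ) * d' *
      ((ArithmeticFunction.moebius (q/d) : ℝ) * (ArithmeticFunction.moebius (q'/d') : ℝ))) *
      (∑ n ∈ Finset.Icc 1 ⌊X⌋₊, if Nat.lcm d d' ∣ n then (1:ℝ) else 0) := by
    unfold ram
    simp_rw [Finset.sum_mul_sum, Finset.mul_sum]
    rw [Finset.sum_comm]
    apply Finset.sum_congr rfl
    intro d hd
    rw [Finset.sum_comm]
    apply Finset.sum_congr rfl
    intro d' hd'
    apply Finset.sum_congr rfl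
    intro n _
    by_cases ha : d ∣ n <;> by_cases hb : d' ∣ n <;> simp [ha, hb, Nat.lcm_dvd_iff]
    ring
  rw [h1, ← ram_main q q' hq hq', Finset.mul_sum, ← Finset.sum_sub_distrib]
  calc _ ≤ ∑ d ∈ q.divisors, ∑ d' ∈ q'.divisors, (d:ℝ) * d' := by
        refine (Finset.abs_sum_le_sum_abs _ _).trans (Finset.sum_le_sum fun d hd => ?_)
        rw [Finset.mul_sum, ← Finset.sum_sub_distrib]
        refine (Finset.abs_sum_le_sum_abs _ _).trans (Finset.sum_le_sum fun d' hd' => ?_)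
        have hd0 : 0 < d := Nat.pos_of_mem_divisors hd
        have hd0' : 0 < d' := Nat.pos_of_mem_divisors hd'
        have hl := Nat.lcm_pos hd0 hd0'
        have hc := aux_count X (Nat.lcm d d') hX hl
        have hgl : (Nat.gcd d d' : ℝ) = d * d' / (Nat.lcm d d' : ℕ) := by
          rw [eq_div_iff (by positivity)]
          exact_mod_cast Nat.gcd_mul_lcm d d'
        set c := ∑ n ∈ Finset.Icc 1 ⌊X⌋₊, if Nat.lcm d d' ∣ n then (1:ℝ) else 0
        set m1 := (ArithmeticFunction.moebius (q/d) : ℝ) with hm1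
        set m2 := (ArithmeticFunction.moebius (q'/d') : ℝ) with hm2
        have hb1 : |m1| ≤ 1 := mu_abs_le _
        have hb2 : |m2| ≤ 1 := mu_abs_le _
        rw [hgl]
        have : (d:ℝ) * d' * (m1 * m2) * c - X * (d * d' / (Nat.lcm d d' : ℕ) * (m1 * m2))
          = (d:ℝ) * d' * ((m1 * m2) * (c - X / (Nat.lcm d d' : ℕ))) := by ring
        rw [this, abs_mul, abs_of_nonneg (by positivity : (0:ℝ) ≤ (d:ℝ) * d'), abs_mul, abs_mul]
        have h3 : |m1| * |m2| * |c - X / (Nat.lcm d d' : ℕ)| ≤ 1 * 1 * 1 := by gcongr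
        calc _ ≤ (d:ℝ) * d' * (1 * 1 * 1) := by gcongr
          _ = _ := by ring
    _ = (∑ d ∈ q.divisors, (d:ℝ)) * (∑ d ∈ q'.divisors, (d:ℝ)) := by
        rw [Finset.sum_mul_sum]
    _ ≤ _ := by
        gcongr
        · exact sum_div_le q
        · exact sum_div_le q'

/-- Selberg's upper bound sieve. -/
theorem selberg (P : ℕ) (hP : Squarefree P) (X : ℝ) (hX : 0 ≤ X) (z : ℕ) (S : ℝ)
    (hS : S = ∑ q ∈ P.divisors.filter (· ≤ z), 1 / (Nat.totient q : ℝ)) :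
    (((Finset.Icc 1 ⌊X⌋₊).filter (fun n => Nat.Coprime n P)).card : ℝ) * S^2
      ≤ X * S + (z:ℝ)^6 := by
  set D := P.divisors.filter (· ≤ z) with hD
  have hP0 : P ≠ 0 := hP.ne_zero
  have hDpos : ∀ q ∈ D, 0 < q := fun q hq =>
    Nat.pos_of_mem_divisors (Finset.mem_filter.1 hq).1
  let a : ℕ → ℝ := fun q => (ArithmeticFunction.moebius q : ℝ) / Nat.totient q
  have hmu : ∀ q ∈ D, (ArithmeticFunction.moebius q : ℝ)^2 = 1 := by
    intro q hq
    have hd := Nat.dvd_of_mem_divisors (Finset.mem_filter.1 hq).1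
    have := ArithmeticFunction.moebius_sq_eq_one_of_squarefree (hP.squarefree_of_dvd hd)
    exact_mod_cast this
  have hrough : ∀ n, Nat.Coprime n P → ∑ q ∈ D, a q * ram q n = S := by
    intro n hn
    rw [hS]
    apply Finset.sum_congr rfl
    intro q hq
    have hd := Nat.dvd_of_mem_divisors (Finset.mem_filter.1 hq).1
    have hr : ram q n = (ArithmeticFunction.moebius q : ℝ) := by
      unfold ram
      rw [Finset.sum_eq_single 1]
      · simp
      · intro b hb hb1
        rw [if_neg]
        intro hbn
        have hbP : b ∣ P := (Nat.dvd_of_mem_divisors hb).trans hd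
        exact hb1 (Nat.eq_one_of_dvd_coprimes hn hbn hbP)
      · intro h; exact absurd (Nat.one_mem_divisors.2 (hDpos q hq).ne') h
    rw [hr]
    have := hmu q hq
    simp only [a]
    rw [← this]; ring
  calc (((Finset.Icc 1 ⌊X⌋₊).filter (fun n => Nat.Coprime n P)).card : ℝ) * S^2
      = ∑ n ∈ (Finset.Icc 1 ⌊X⌋₊).filter (fun n => Nat.Coprime n P), (∑ q ∈ D, a q * ram q n)^2 := by
        rw [Finset.sum_congr rfl (fun n hn => by rw [hrough n (Finset.mem_filter.1 hn).2])]
        simp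
    _ ≤ ∑ n ∈ Finset.Icc 1 ⌊X⌋₊, (∑ q ∈ D, a q * ram q n)^2 := by
        apply Finset.sum_le_sum_of_subset_of_nonneg (Finset.filter_subset _ _)
        intros; positivity
    _ = ∑ q ∈ D, ∑ q' ∈ D, a q * a q' * ∑ n ∈ Finset.Icc 1 ⌊X⌋₊, ram q n * ram q' n := by
        simp_rw [sq, Finset.sum_mul_sum, Finset.mul_sum]
        rw [Finset.sum_comm]
        apply Finset.sum_congr rfl
        intro q _
        rw [Finset.sum_comm]
        apply Finset.sum_congr rfl
        intro q' _
        apply Finset.sum_congr rfl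
        intro n _
        ring
    _ ≤ ∑ q ∈ D, ∑ q' ∈ D, (X * (if q = q' then 1 / (Nat.totient q : ℝ) else 0)
          + (z:ℝ)^2 * (z:ℝ)^2) := by
        refine Finset.sum_le_sum fun q hq => Finset.sum_le_sum fun q' hq' => ?_
        have ho := ram_orth X hX q q' (hDpos q hq) (hDpos q' hq')
        set c := ∑ n ∈ Finset.Icc 1 ⌊X⌋₊, ram q n * ram q' n
        set m := X * (if q = q' then (Nat.totient q : ℝ) else 0) with hm
        have hab : ∀ q ∈ D, |a q| ≤ 1 := by
          intro q hq
          simp only [a]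
          have ht : (1:ℝ) ≤ Nat.totient q := by
            exact_mod_cast Nat.totient_pos.2 (hDpos q hq)
          rw [abs_div, abs_of_pos (by linarith : (0:ℝ) < Nat.totient q), div_le_one (by linarith)]
          exact (mu_abs_le q).trans ht
        have hz : (q:ℝ) ≤ z := by exact_mod_cast (Finset.mem_filter.1 hq).2
        have hz' : (q':ℝ) ≤ z := by exact_mod_cast (Finset.mem_filter.1 hq').2
        have e1 : a q * a q' * c = a q * a q' * m + a q * a q' * (c - m) := by ring
        have e2 : a q * a q' * m = X * (if q = q' then 1 / (Nat.totient q : ℝ) else 0) := by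
          by_cases h : q = q'
          · subst h
            have ht : (Nat.totient q : ℝ) ≠ 0 := by
              exact_mod_cast (Nat.totient_pos.2 (hDpos q hq)).ne'
            simp only [hm, a, if_true]
            have := hmu q hq
            field_simp
            rw [this]; ring
          · simp [hm, h]
        rw [e1, e2]
        refine add_le_add le_rfl ?_
        calc a q * a q' * (c - m) ≤ |a q * a q' * (c - m)| := le_abs_self _
          _ = |a q| * |a q'| * |c - m| := by rw [abs_mul, abs_mul]
          _ ≤ 1 * 1 * ((q:ℝ)^2 * (q':ℝ)^2) := by
              gcongr
              · exact hab q hq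
              · exact hab q' hq'
          _ ≤ (z:ℝ)^2 * (z:ℝ)^2 := by rw [one_mul, one_mul]; gcongr
    _ ≤ X * S + (z:ℝ)^6 := by
        have hcard : (D.card : ℝ) ≤ z := by
          have : D ⊆ Finset.Icc 1 z := by
            intro q hq
            rw [Finset.mem_Icc]
            exact ⟨hDpos q hq, (Finset.mem_filter.1 hq).2⟩
          have := Finset.card_le_card this
          rw [Nat.card_Icc] at this
          exact_mod_cast (by lia : D.card ≤ z)
        simp_rw [Finset.sum_add_distrib]
        gcongr ?_ + ?_
        · rw [hS, Finset.mul_sum]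
          apply le_of_eq
          apply Finset.sum_congr rfl
          intro q hq
          rw [← Finset.mul_sum, Finset.sum_ite_eq, if_pos hq]
        · simp only [Finset.sum_const, nsmul_eq_mul]
          calc (D.card:ℝ) * (D.card * ((z:ℝ)^2 * (z:ℝ)^2)) ≤ z * (z * ((z:ℝ)^2 * (z:ℝ)^2)) := by gcongr
            _ = (z:ℝ)^6 := by ring

def PP (K : ℕ) : ℕ := ∏ p ∈ K.primesBelow, p

def VV (K : ℕ) : ℝ := ∏ p ∈ K.primesBelow, (1 - 1 / (p:ℝ))

theorem PP_primeFactors (K : ℕ) : (PP K).primeFactors = K.primesBelow :=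
  Nat.primeFactors_prod (fun _ hp => Nat.prime_of_mem_primesBelow hp)

theorem PP_squarefree (K : ℕ) : Squarefree (PP K) := by
  unfold PP
  refine Finset.squarefree_prod_of_pairwise_isCoprime ?_ ?_
  · intro p hp q hq hpq
    exact Nat.coprime_iff_isRelPrime.1 ((Nat.coprime_primes (Nat.prime_of_mem_primesBelow hp)
      (Nat.prime_of_mem_primesBelow hq)).2 hpq)
  · intro p hp
    exact (Nat.prime_of_mem_primesBelow hp).squarefree

def phiInv : ArithmeticFunction ℝ := ⟨fun n => 1 / (Nat.totient n : ℝ), by simp⟩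

theorem phiInv_mult : phiInv.IsMultiplicative := by
  rw [ArithmeticFunction.IsMultiplicative.iff_ne_zero]
  constructor
  · simp [phiInv]
  · intro m n _ _ h
    simp [phiInv, Nat.totient_mul h, mul_comm]

theorem VV_pos (K : ℕ) : 0 < VV K := by
  apply Finset.prod_pos
  intro p hp
  have h2 : (2:ℝ) ≤ p := by exact_mod_cast (Nat.prime_of_mem_primesBelow hp).two_le
  have : 1 / (p:ℝ) ≤ 1 / 2 := by gcongr
  linarith

theorem full_sum (K : ℕ) : (∑ q ∈ (PP K).divisors, 1 / (Nat.totient q : ℝ)) * VV K = 1 := by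
  have h := phiInv_mult.prodPrimeFactors_one_add_of_squarefree (PP_squarefree K)
  have h' : ∑ q ∈ (PP K).divisors, 1 / (Nat.totient q : ℝ) = ∑ q ∈ (PP K).divisors, phiInv q := rfl
  rw [h', ← h, PP_primeFactors, VV, ← Finset.prod_mul_distrib]
  apply Finset.prod_eq_one
  intro p hp
  have hp' := Nat.prime_of_mem_primesBelow hp
  have h2 : (2:ℝ) ≤ p := by exact_mod_cast hp'.two_le
  have : phiInv p = 1 / ((p:ℝ) - 1) := by
    show 1 / (Nat.totient p : ℝ) = _
    rw [Nat.totient_prime hp', Nat.cast_sub hp'.one_le]; simp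
  rw [this]
  have h3 : (p:ℝ) - 1 ≠ 0 := by linarith
  have h4 : (p:ℝ) ≠ 0 := by linarith
  field_simp
  ring

theorem inner_sum_phi (P p : ℕ) (hP : Squarefree P) (hp : p.Prime) (hpP : p ∣ P) :
    (∑ q ∈ P.divisors, if p ∣ q then 1 / (Nat.totient q : ℝ) else 0) =
      (∑ q ∈ P.divisors, 1 / (Nat.totient q : ℝ)) / p := by
  obtain ⟨m, rfl⟩ := hpP
  have hm0 : m ≠ 0 := right_ne_zero_of_mul hP.ne_zero
  have hco : Nat.Coprime p m := Nat.coprime_of_squarefree_mul hP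
  have h2 : (2:ℝ) ≤ p := by exact_mod_cast hp.two_le
  have e1 : (∑ q ∈ (p*m).divisors, if p ∣ q then 1 / (Nat.totient q : ℝ) else 0)
      = (1 / ((p:ℝ)-1)) * ∑ d ∈ m.divisors, 1 / (Nat.totient d : ℝ) := by
    rw [← Finset.sum_filter, Finset.mul_sum]
    symm
    apply Finset.sum_bij (fun d _ => p * d)
    · intro d hd
      rw [Nat.mem_divisors] at hd
      rw [Finset.mem_filter, Nat.mem_divisors]
      exact ⟨⟨Nat.mul_dvd_mul_left p hd.1, hP.ne_zero⟩, Dvd.intro _ rfl⟩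
    · intro a _ b _ hab
      exact Nat.eq_of_mul_eq_mul_left hp.pos hab
    · intro b hb
      rw [Finset.mem_filter, Nat.mem_divisors] at hb
      obtain ⟨⟨h1, h2⟩, c, rfl⟩ := hb
      exact ⟨c, by rw [Nat.mem_divisors]; exact ⟨Nat.dvd_of_mul_dvd_mul_left hp.pos h1, hm0⟩, rfl⟩
    · intro d hd
      have hcd : Nat.Coprime p d := hco.coprime_dvd_right (Nat.dvd_of_mem_divisors hd)
      rw [Nat.totient_mul hcd, Nat.totient_prime hp, Nat.cast_mul, Nat.cast_sub hp.one_le,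
        Nat.cast_one]
      rw [div_mul_div_comm, one_mul]
  have e2 : (∑ q ∈ (p*m).divisors, if ¬ p ∣ q then 1 / (Nat.totient q : ℝ) else 0)
      = ∑ d ∈ m.divisors, 1 / (Nat.totient d : ℝ) := by
    rw [← Finset.sum_filter]
    apply Finset.sum_congr _ (fun _ _ => rfl)
    ext d
    rw [Finset.mem_filter, Nat.mem_divisors, Nat.mem_divisors]
    constructor
    · rintro ⟨⟨h1, _⟩, h3⟩
      exact ⟨((hp.coprime_iff_not_dvd.2 h3).symm).dvd_of_dvd_mul_left h1, hm0⟩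
    · rintro ⟨h1, _⟩
      refine ⟨⟨h1.mul_left p, hP.ne_zero⟩, ?_⟩
      intro hpd
      exact (hp.coprime_iff_not_dvd.1 hco) (hpd.trans h1)
  have e3 : (∑ q ∈ (p*m).divisors, 1 / (Nat.totient q : ℝ)) =
      (∑ q ∈ (p*m).divisors, if p ∣ q then 1 / (Nat.totient q : ℝ) else 0) +
      (∑ q ∈ (p*m).divisors, if ¬ p ∣ q then 1 / (Nat.totient q : ℝ) else 0) := by
    rw [← Finset.sum_add_distrib]
    apply Finset.sum_congr rfl
    intro q _
    by_cases h : p ∣ q <;> simp [h]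
  rw [e3, e1, e2]
  have h3 : (p:ℝ) - 1 ≠ 0 := by linarith
  have h4 : (p:ℝ) ≠ 0 := by linarith
  field_simp
  ring

theorem S_lower (K z : ℕ) (hz : 1 < z) :
    1 - (∑ p ∈ K.primesBelow, Real.log p / p) / Real.log z ≤
    (∑ q ∈ (PP K).divisors.filter (· ≤ z), 1 / (Nat.totient q : ℝ)) * VV K := by
  have hV := VV_pos K
  have hF := full_sum K
  set F := ∑ q ∈ (PP K).divisors, 1 / (Nat.totient q : ℝ) with hFdef
  have hlz : 0 < Real.log z := Real.log_pos (by exact_mod_cast hz)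
  set M := ∑ p ∈ K.primesBelow, Real.log p / p with hM
  have hlog : ∑ q ∈ (PP K).divisors, 1 / (Nat.totient q : ℝ) * Real.log q = F * M := by
    have h1 : ∀ q ∈ (PP K).divisors, 1 / (Nat.totient q : ℝ) * Real.log q
        = ∑ p ∈ K.primesBelow, Real.log p * (if p ∣ q then 1 / (Nat.totient q : ℝ) else 0) := by
      intro q hq
      have hqd := Nat.dvd_of_mem_divisors hq
      have hsq := (PP_squarefree K).squarefree_of_dvd hqd
      have h0 : Real.log q = ∑ p ∈ q.primeFactors, Real.log p := by
        rw [← Real.log_prod (fun p hp => by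
          have := (Nat.prime_of_mem_primeFactors hp).pos
          positivity)]
        conv_lhs => rw [← Nat.prod_primeFactors_of_squarefree hsq]
        push_cast; rfl
      have h00 : q.primeFactors = K.primesBelow.filter (· ∣ q) := by
        ext p
        rw [Finset.mem_filter, ← PP_primeFactors, Nat.mem_primeFactors, Nat.mem_primeFactors]
        constructor
        · rintro ⟨a, b, c⟩
          exact ⟨⟨a, b.trans hqd, (PP_squarefree K).ne_zero⟩, b⟩
        · rintro ⟨⟨a, b, c⟩, d⟩
          exact ⟨a, d, hsq.ne_zero⟩
      rw [h0, h00, Finset.sum_filter, Finset.mul_sum]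
      apply Finset.sum_congr rfl
      intro p _
      split_ifs <;> ring
    rw [Finset.sum_congr rfl h1, Finset.sum_comm, hM, Finset.mul_sum]
    apply Finset.sum_congr rfl
    intro p hp
    have hpp := Nat.prime_of_mem_primesBelow hp
    have hpd : p ∣ PP K := by
      rw [← PP_primeFactors] at hp
      exact Nat.dvd_of_mem_primeFactors hp
    rw [← Finset.mul_sum, inner_sum_phi _ p (PP_squarefree K) hpp hpd]
    ring
  have hsplit : F = (∑ q ∈ (PP K).divisors.filter (· ≤ z), 1 / (Nat.totient q : ℝ)) +
      ∑ q ∈ (PP K).divisors.filter (fun q => ¬ q ≤ z), 1 / (Nat.totient q : ℝ) :=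
    (Finset.sum_filter_add_sum_filter_not _ _ _).symm
  have htail : (∑ q ∈ (PP K).divisors.filter (fun q => ¬ q ≤ z), 1 / (Nat.totient q : ℝ))
      ≤ F * M / Real.log z := by
    rw [le_div_iff₀ hlz, ← hlog, Finset.sum_mul]
    calc _ ≤ ∑ q ∈ (PP K).divisors.filter (fun q => ¬ q ≤ z),
            1 / (Nat.totient q : ℝ) * Real.log q := by
          apply Finset.sum_le_sum
          intro q hq
          have h1 := (Finset.mem_filter.1 hq).2
          gcongr
          lia
      _ ≤ _ := by
          apply Finset.sum_le_sum_of_subset_of_nonneg (Finset.filter_subset _ _)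
          intro q _ _
          have := Real.log_natCast_nonneg q
          positivity
  set S := ∑ q ∈ (PP K).divisors.filter (· ≤ z), 1 / (Nat.totient q : ℝ)
  have : F - F * M / Real.log z ≤ S := by linarith
  calc 1 - M / Real.log z = (F * VV K) * (1 - M / Real.log z) := by rw [hF, one_mul]
    _ = (F - F * M / Real.log z) * VV K := by ring
    _ ≤ S * VV K := by gcongr

def sp (K n : ℕ) : ℕ := (n.factorization.filter (fun p => p < K)).prod (fun p k => p ^ k)

def rp (K n : ℕ) : ℕ := (n.factorization.filter (fun p => ¬ p < K)).prod (fun p k => p ^ k)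

theorem sp_mul_rp (K n : ℕ) (hn : n ≠ 0) : sp K n * rp K n = n := by
  unfold sp rp
  rw [Finsupp.prod_filter_mul_prod_filter_not]
  exact Nat.prod_factorization_pow_eq_self hn

theorem filt_support {n p : ℕ} {q : ℕ → Prop} [DecidablePred q] (h : p ∈ (n.factorization.filter q).support) :
    p.Prime := by
  rw [Finsupp.support_filter, Finset.mem_filter] at h
  exact Nat.prime_of_mem_primeFactors h.1

theorem sp_factorization (K n : ℕ) :
    (sp K n).factorization = n.factorization.filter (fun p => p < K) :=
  Nat.prod_pow_factorization_eq_self (fun _ h => filt_support h)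

theorem rp_factorization (K n : ℕ) :
    (rp K n).factorization = n.factorization.filter (fun p => ¬ p < K) :=
  Nat.prod_pow_factorization_eq_self (fun _ h => filt_support h)

theorem sp_primeFactors (K n : ℕ) :
    (sp K n).primeFactors = n.primeFactors.filter (fun p => p < K) := by
  rw [← Nat.support_factorization, sp_factorization, Finsupp.support_filter,
    Nat.support_factorization]

theorem rp_primeFactors (K n : ℕ) :
    (rp K n).primeFactors = n.primeFactors.filter (fun p => ¬ p < K) := by
  rw [← Nat.support_factorization, rp_factorization, Finsupp.support_filter,
    Nat.support_factorization]

theorem sp_ne_zero (K n : ℕ) (hn : n ≠ 0) : sp K n ≠ 0 := by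
  intro h
  have := sp_mul_rp K n hn
  rw [h, zero_mul] at this
  exact hn this.symm

theorem rp_ne_zero (K n : ℕ) (hn : n ≠ 0) : rp K n ≠ 0 := by
  intro h
  have := sp_mul_rp K n hn
  rw [h, mul_zero] at this
  exact hn this.symm

theorem sp_smooth (K n : ℕ) (hn : n ≠ 0) : sp K n ∈ Nat.smoothNumbers K := by
  rw [Nat.mem_smoothNumbers]
  refine ⟨sp_ne_zero K n hn, ?_⟩
  intro p hp
  have : p ∈ (sp K n).primeFactors := Nat.mem_primeFactors_iff_mem_primeFactorsList.2 hp
  rw [sp_primeFactors, Finset.mem_filter] at this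
  exact this.2

theorem rp_coprime (K n : ℕ) (hn : n ≠ 0) : Nat.Coprime (rp K n) (PP K) := by
  rw [← Nat.disjoint_primeFactors (rp_ne_zero K n hn) (PP_squarefree K).ne_zero,
    rp_primeFactors, PP_primeFactors, Finset.disjoint_left]
  intro p hp hp'
  exact (Finset.mem_filter.1 hp).2 (Nat.lt_of_mem_primesBelow hp')

theorem log_sp (K n : ℕ) :
    Real.log (sp K n) = ∑ p ∈ n.primeFactors.filter (fun p => p < K),
      (n.factorization p : ℝ) * Real.log p := by
  unfold sp
  rw [Finsupp.prod, Finsupp.support_filter, Nat.support_factorization]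
  push_cast
  rw [Real.log_prod]
  · apply Finset.sum_congr rfl
    intro p hp
    rw [Finsupp.filter_apply_pos (fun p => p < K) _ (Finset.mem_filter.1 hp).2, Real.log_pow]
  · intro p hp
    have := (Nat.prime_of_mem_primeFactors (Finset.mem_filter.1 hp).1).pos
    positivity

theorem geom_pow_le (p : ℕ) (hp : 2 ≤ p) (L : ℕ) :
    ∑ k ∈ Finset.Ico 1 L, 1 / (p:ℝ)^k ≤ 2 / p := by
  have h2 : (2:ℝ) ≤ p := by exact_mod_cast hp
  rw [Finset.sum_Ico_eq_sum_range]
  have h1 : ∀ k ∈ Finset.range (L-1), 1 / (p:ℝ)^(1+k) = (1/p) * ((1/(p:ℝ))^k) := by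
    intro k _
    rw [pow_add, pow_one, one_div_pow, div_mul_div_comm, one_mul]
  rw [Finset.sum_congr rfl h1, ← Finset.mul_sum]
  have h3 := mul_neg_geom_sum (1/(p:ℝ)) (L-1)
  have h4 : 1/(p:ℝ) ≤ 1/2 := by gcongr
  have h5 : 0 ≤ (1/(p:ℝ))^(L-1) := by positivity
  set s := ∑ i ∈ Finset.range (L-1), (1/(p:ℝ))^i
  have hs : 0 ≤ s := Finset.sum_nonneg (fun i _ => by positivity)
  have : s ≤ 2 := by nlinarith
  calc 1/(p:ℝ) * s ≤ 1/(p:ℝ) * 2 := by gcongr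
    _ = _ := by ring

theorem sum_log_sp (K N : ℕ) :
    ∑ n ∈ Finset.Icc 1 N, Real.log (sp K n) ≤
      2 * N * ∑ p ∈ K.primesBelow, Real.log p / p := by
  have h1 : ∀ n ∈ Finset.Icc 1 N, Real.log (sp K n) ≤
      ∑ p ∈ K.primesBelow, ∑ k ∈ Finset.Ico 1 (N+1), Real.log p * (if p^k ∣ n then (1:ℝ) else 0) := by
    intro n hn
    rw [Finset.mem_Icc] at hn
    rw [log_sp]
    calc _ ≤ ∑ p ∈ n.primeFactors.filter (fun p => p < K),
          ∑ k ∈ Finset.Ico 1 (N+1), Real.log p * (if p^k ∣ n then (1:ℝ) else 0) := by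
          apply Finset.sum_le_sum
          intro p hp
          have hpp := Nat.prime_of_mem_primeFactors (Finset.mem_filter.1 hp).1
          rw [← Finset.mul_sum, mul_comm]
          have := Real.log_natCast_nonneg p
          gcongr
          rw [Nat.factorization_eq_card_pow_dvd n hpp, Finset.sum_ite]
          simp only [Finset.sum_const_zero, add_zero, Finset.sum_const, nsmul_eq_mul, mul_one]
          norm_cast
          apply Finset.card_le_card
          intro i hi
          rw [Finset.mem_filter, Finset.mem_Ico] at hi ⊢
          exact ⟨⟨hi.1.1, by lia⟩, hi.2⟩
      _ ≤ _ := by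
          apply Finset.sum_le_sum_of_subset_of_nonneg
          · intro p hp
            rw [Finset.mem_filter] at hp
            exact Nat.mem_primesBelow.2 ⟨hp.2, Nat.prime_of_mem_primeFactors hp.1⟩
          · intro p _ _
            apply Finset.sum_nonneg
            intro k _
            have := Real.log_natCast_nonneg p
            positivity
  refine (Finset.sum_le_sum h1).trans ?_
  rw [Finset.sum_comm, Finset.mul_sum]
  apply Finset.sum_le_sum
  intro p hp
  have hpp := Nat.prime_of_mem_primesBelow hp
  have hl := Real.log_natCast_nonneg p
  rw [Finset.sum_comm]
  calc _ = ∑ k ∈ Finset.Ico 1 (N+1), Real.log p *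
          ∑ n ∈ Finset.Icc 1 N, (if p^k ∣ n then (1:ℝ) else 0) := by
        simp_rw [Finset.mul_sum]
    _ ≤ ∑ k ∈ Finset.Ico 1 (N+1), Real.log p * (N / ((p^k : ℕ):ℝ)) := by
        gcongr with k hk
        exact aux_count_le N (p^k)
    _ = Real.log p * N * ∑ k ∈ Finset.Ico 1 (N+1), 1 / (p:ℝ)^k := by
        rw [Finset.mul_sum]; apply Finset.sum_congr rfl; intro k _; push_cast; ring
    _ ≤ Real.log p * N * (2 / p) := by
        gcongr
        exact geom_pow_le p hpp.two_le _
    _ = _ := by ring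

theorem fiber_le (K a : ℕ) (ha : a ≠ 0) (x : ℝ) :
    ((Finset.Icc 1 ⌊x⌋₊).filter (fun n => sp K n = a)).card ≤
      ((Finset.Icc 1 ⌊x / a⌋₊).filter (fun n => Nat.Coprime n (PP K))).card := by
  apply Finset.card_le_card_of_injOn (rp K)
  · intro n hn
    have hn' := Finset.mem_filter.1 hn
    rw [Finset.mem_Icc] at hn'
    have hn0 : n ≠ 0 := by lia
    have h := sp_mul_rp K n hn0
    rw [hn'.2] at h
    rw [Finset.mem_coe, Finset.mem_filter, Finset.mem_Icc]
    refine ⟨⟨Nat.pos_of_ne_zero (rp_ne_zero K n hn0), ?_⟩, rp_coprime K n hn0⟩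
    rw [Nat.floor_div_natCast, Nat.le_div_iff_mul_le (Nat.pos_of_ne_zero ha), mul_comm, h]
    exact hn'.1.2
  · intro n hn m hm hnm
    have hn' := Finset.mem_filter.1 hn
    have hm' := Finset.mem_filter.1 hm
    rw [Finset.mem_Icc] at hn' hm'
    have h := sp_mul_rp K n (by lia)
    have h' := sp_mul_rp K m (by lia)
    rw [← h, ← h', hn'.2, hm'.2, hnm]

theorem euler_smooth (G : ℕ → ℂ) (h1 : G 1 = 1) (hb : ∀ n, ‖G n‖ ≤ 1)
    (hm : ∀ m n, m ≠ 0 → n ≠ 0 → Nat.Coprime m n → G (m * n) = G m * G n) (K : ℕ) :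
    HasSum (fun n : ℕ => G n * ((if n ∈ Nat.smoothNumbers K then VV K / n else 0 : ℝ) : ℂ))
      (∏ p ∈ K.primesBelow, ((1 - 1/(p:ℂ)) * ∑' ν : ℕ, G (p ^ ν) / (p:ℂ)^ν)) := by
  let F : ℕ → ℂ := fun n => G n / n
  have hF1 : F 1 = 1 := by simp [F, h1]
  have hFm : ∀ {m n : ℕ}, Nat.Coprime m n → F (m * n) = F m * F n := by
    intro m n hmn
    by_cases h0 : m = 0
    · simp [F, h0]
    by_cases h0' : n = 0
    · simp [F, h0']
    simp only [F, hm m n h0 h0' hmn]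
    push_cast
    rw [div_mul_div_comm]
  have hs : ∀ {p : ℕ}, p.Prime → Summable (fun n : ℕ ↦ ‖F (p ^ n)‖) := by
    intro p hp
    have h2 : (2:ℝ) ≤ p := by exact_mod_cast hp.two_le
    refine Summable.of_nonneg_of_le (fun n => norm_nonneg _) (fun n => ?_)
      (summable_geometric_of_lt_one (r := 1/(p:ℝ)) (by positivity) (by
        rw [div_lt_one (by positivity)]; linarith))
    simp only [F, norm_div, Nat.cast_pow, norm_pow, Complex.norm_natCast]
    rw [one_div_pow]
    gcongr
    exact hb _
  have h := (EulerProduct.summable_and_hasSum_smoothNumbers_prod_primesBelow_tsum hF1 hFm hs K).2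
  rw [Finset.prod_mul_distrib]
  have hV : (∏ p ∈ K.primesBelow, (1 - 1/(p:ℂ))) = ((VV K : ℝ) : ℂ) := by
    unfold VV; push_cast; rfl
  rw [hV]
  have h' := (hasSum_subtype_iff_indicator (f := F) (s := Nat.smoothNumbers K)).1 h
  have h'' := h'.mul_left ((VV K : ℝ) : ℂ)
  have e1 : (fun n : ℕ => G n * ((if n ∈ Nat.smoothNumbers K then VV K / n else 0 : ℝ) : ℂ))
      = fun i => ((VV K : ℝ) : ℂ) * (Nat.smoothNumbers K).indicator F i := by
    funext n
    by_cases hn : n ∈ Nat.smoothNumbers K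
    · simp [hn, F]; ring
    · simp [hn]
  have e2 : (∏ p ∈ K.primesBelow, ∑' ν : ℕ, G (p ^ ν) / (p:ℂ)^ν)
      = ∏ p ∈ K.primesBelow, ∑' n : ℕ, F (p ^ n) := by
    apply Finset.prod_congr rfl
    intro p hp
    simp [F]
  rw [e1, e2]
  exact h''

theorem Q_hasSum (K : ℕ) :
    HasSum (fun n : ℕ => (if n ∈ Nat.smoothNumbers K then VV K / n else 0 : ℝ)) 1 := by
  have h := euler_smooth (fun _ => 1) rfl (by simp) (by simp) K
  have h1 : (∏ p ∈ K.primesBelow, ((1 - 1/(p:ℂ)) * ∑' ν : ℕ, (1:ℂ) / (p:ℂ)^ν)) = ((1:ℝ):ℂ) := by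
    rw [Complex.ofReal_one]
    apply Finset.prod_eq_one
    intro p hp
    have hpp := Nat.prime_of_mem_primesBelow hp
    have h2 : (2:ℝ) ≤ p := by exact_mod_cast hpp.two_le
    have hn : ‖1/(p:ℂ)‖ < 1 := by
      rw [norm_div, norm_one, Complex.norm_natCast, div_lt_one (by positivity)]
      linarith
    have e : ∀ ν : ℕ, (1:ℂ)/(p:ℂ)^ν = (1/(p:ℂ))^ν := fun ν => by rw [one_div_pow]
    simp_rw [e]
    rw [tsum_geometric_of_norm_lt_one hn]
    apply mul_inv_cancel₀
    intro h0
    have : 1/(p:ℂ) = 1 := by linear_combination -h0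
    rw [this] at hn
    simp at hn
  rw [h1] at h
  simp only [one_mul] at h
  exact Complex.hasSum_ofReal.1 h

theorem tv (G : ℕ → ℂ) (h1 : G 1 = 1) (hb : ∀ n, ‖G n‖ ≤ 1)
    (hm : ∀ m n, m ≠ 0 → n ≠ 0 → Nat.Coprime m n → G (m * n) = G m * G n) (K z : ℕ)
    (hz : 1 ≤ z) (x w δ : ℝ) (hx : 1 ≤ x) (hw : 1 < w) (hδ0 : 0 ≤ δ)
    (hδ : 1 ≤ (∑ q ∈ (PP K).divisors.filter (· ≤ z), 1 / (Nat.totient q : ℝ)) * VV K * (1 + δ)) :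
    ‖((x)⁻¹ : ℝ) * (∑ n ∈ Finset.Icc 1 ⌊x⌋₊, G (sp K n)) -
      (∏ p ∈ K.primesBelow, ((1 - 1/(p:ℂ)) * ∑' ν : ℕ, G (p ^ ν) / (p:ℂ)^ν))‖ ≤
      1 / x + 2 * (δ + w * z^6 / x +
        2 * (∑ p ∈ K.primesBelow, Real.log p / p) / Real.log w) := by
  have hx0 : 0 < x := by linarith
  have hlw : 0 < Real.log w := Real.log_pos hw
  set I := Finset.Icc 1 ⌊x⌋₊ with hI
  set A := I.image (sp K) with hA
  set Q : ℕ → ℝ := fun n => (if n ∈ Nat.smoothNumbers K then VV K / n else 0 : ℝ) with hQ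
  set P : ℕ → ℝ := fun a => x⁻¹ * ((I.filter (fun n => sp K n = a)).card : ℝ) with hP
  have hQ0 : ∀ n, 0 ≤ Q n := by
    intro n; simp only [hQ]; have := VV_pos K; split_ifs <;> positivity
  have hP0 : ∀ n, 0 ≤ P n := by intro n; simp only [hP]; positivity
  have hPA : ∀ a, a ∉ A → P a = 0 := by
    intro a ha
    simp only [hP]
    rw [Finset.filter_eq_empty_iff.2]
    · simp
    · intro n hn h
      exact ha (Finset.mem_image.2 ⟨n, hn, h⟩)
  have hsumG : ((x)⁻¹ : ℝ) * (∑ n ∈ I, G (sp K n)) = ∑ a ∈ A, G a * ((P a : ℝ) : ℂ) := by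
    rw [Finset.sum_comp G (sp K), Finset.mul_sum]
    apply Finset.sum_congr rfl
    intro a _
    simp only [hP, nsmul_eq_mul]
    push_cast
    ring
  have hsumP : ∑ a ∈ A, P a = x⁻¹ * ⌊x⌋₊ := by
    simp only [hP]
    rw [← Finset.mul_sum]
    congr 1
    have := Finset.sum_comp (s := I) (fun _ => (1:ℝ)) (sp K)
    simp only [nsmul_eq_mul, mul_one, Finset.sum_const] at this
    rw [← this, hI, Nat.card_Icc]; simp
  have hHP : HasSum P (x⁻¹ * ⌊x⌋₊) := by
    rw [← hsumP]; exact hasSum_sum_of_ne_finset_zero (fun a ha => hPA a ha)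
  have hHGP : HasSum (fun a => G a * ((P a : ℝ) : ℂ)) (((x)⁻¹ : ℝ) * (∑ n ∈ I, G (sp K n))) := by
    rw [hsumG]
    exact hasSum_sum_of_ne_finset_zero (fun a ha => by rw [hPA a ha]; simp)
  have hHQ : HasSum Q 1 := Q_hasSum K
  have hHGQ := euler_smooth G h1 hb hm K
  have hHpos : HasSum (fun a => max (P a - Q a) 0) (∑ a ∈ A, max (P a - Q a) 0) :=
    hasSum_sum_of_ne_finset_zero (fun a ha => by
      rw [hPA a ha]; have := hQ0 a; simp [this])
  have hHabs : HasSum (fun a => |P a - Q a|) (1 - x⁻¹ * ⌊x⌋₊ + 2 * ∑ a ∈ A, max (P a - Q a) 0) := by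
    have e1 : (fun a => |P a - Q a|) = fun b => Q b - P b + 2 * max (P b - Q b) 0 := by
      funext a
      rcases le_total (P a - Q a) 0 with h | h
      · rw [max_eq_right h, abs_of_nonpos h]; ring
      · rw [max_eq_left h, abs_of_nonneg h]; ring
    rw [e1]
    exact (hHQ.sub hHP).add (hHpos.mul_left 2)
  have hmain := (hHGP.sub hHGQ).norm_le_of_bounded hHabs (fun a => by
    rw [← mul_sub, ← Complex.ofReal_sub, norm_mul, Complex.norm_real, Real.norm_eq_abs]
    calc _ ≤ 1 * |P a - Q a| := by gcongr; exact hb a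
      _ = _ := one_mul _)
  refine hmain.trans ?_
  have hfl : 1 - x⁻¹ * ⌊x⌋₊ ≤ 1 / x := by
    have := Nat.lt_floor_add_one x
    rw [← mul_le_mul_iff_right₀ hx0]
    have e : x * (1 - x⁻¹ * ⌊x⌋₊) = x - ⌊x⌋₊ := by field_simp
    rw [e, mul_one_div_cancel hx0.ne']
    linarith
  gcongr ?_ + 2 * ?_
  -- bound of the positive part
  set S := ∑ q ∈ (PP K).divisors.filter (· ≤ z), 1 / (Nat.totient q : ℝ) with hS
  have hS1 : 1 ≤ S := by
    have hmem : 1 ∈ (PP K).divisors.filter (· ≤ z) := by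
      rw [Finset.mem_filter]
      exact ⟨Nat.one_mem_divisors.2 (PP_squarefree K).ne_zero, hz⟩
    have := Finset.single_le_sum (f := fun q => 1 / (Nat.totient q : ℝ))
      (fun i _ => by positivity) hmem
    simpa [hS] using this
  have hASm : ∀ a ∈ A, a ∈ Nat.smoothNumbers K := by
    intro a ha
    obtain ⟨n, hn, rfl⟩ := Finset.mem_image.1 ha
    rw [hI, Finset.mem_Icc] at hn
    exact sp_smooth K n (by lia)
  have hsmall : ∀ a ∈ A, max (P a - Q a) 0 ≤ δ * Q a + z^6 / x := by
    intro a ha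
    have hs := hASm a ha
    have ha0 : a ≠ 0 := Nat.ne_zero_of_mem_smoothNumbers hs
    have hapos : (0:ℝ) < a := by positivity
    have hV := VV_pos K
    apply max_le
    · have hc := fiber_le K a ha0 x
      have hsel := selberg (PP K) (PP_squarefree K) (x / a) (by positivity) z S hS
      set Φ := ((Finset.Icc 1 ⌊x / a⌋₊).filter (fun n => Nat.Coprime n (PP K))).card
      have hΦ : (Φ:ℝ) ≤ (x/a) / S + z^6 := by
        have hSpos : 0 < S := by linarith
        have h3 : (Φ:ℝ) ≤ ((x/a) * S + (z:ℝ)^6) / S^2 := by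
          rw [le_div_iff₀ (by positivity)]; exact hsel
        have h4 : ((x/a) * S + (z:ℝ)^6) / S^2 = (x/a)/S + (z:ℝ)^6 / S^2 := by
          field_simp
        have h5 : (z:ℝ)^6 / S^2 ≤ z^6 := by
          apply div_le_self (by positivity)
          exact one_le_pow₀ hS1
        linarith
      have hVS : 1 / S ≤ VV K * (1 + δ) := by
        rw [div_le_iff₀ (by linarith)]; linarith
      have hPa : P a ≤ (1 + δ) * Q a + z^6 / x := by
        have hQa : Q a = VV K / a := by simp only [hQ]; rw [if_pos hs]
        calc P a ≤ x⁻¹ * Φ := by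
              simp only [hP]; gcongr
          _ ≤ x⁻¹ * ((x/a) / S + z^6) := by gcongr
          _ = (1/S) / a + z^6 / x := by field_simp
          _ ≤ (VV K * (1 + δ)) / a + z^6/x := by gcongr
          _ = _ := by rw [hQa]; ring
      linarith
    · have := hQ0 a; positivity
  have hsplit := Finset.sum_filter_add_sum_filter_not A (fun a : ℕ => (a:ℝ) ≤ w)
    (fun a => max (P a - Q a) 0)
  rw [← hsplit]
  have hlow : ∑ a ∈ A.filter (fun a : ℕ => (a:ℝ) ≤ w), max (P a - Q a) 0 ≤ δ + w * z^6 / x := by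
    calc _ ≤ ∑ a ∈ A.filter (fun a : ℕ => (a:ℝ) ≤ w), (δ * Q a + z^6 / x) :=
          Finset.sum_le_sum (fun a ha => hsmall a (Finset.mem_filter.1 ha).1)
      _ = δ * (∑ a ∈ A.filter (fun a : ℕ => (a:ℝ) ≤ w), Q a) +
          ((A.filter (fun a : ℕ => (a:ℝ) ≤ w)).card : ℝ) * (z^6 / x) := by
          rw [Finset.sum_add_distrib, Finset.mul_sum]; simp
      _ ≤ δ * 1 + w * (z^6 / x) := by
          gcongr
          · exact sum_le_hasSum _ (fun i _ => hQ0 i) hHQ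
          · have hsub : A.filter (fun a : ℕ => (a:ℝ) ≤ w) ⊆ Finset.Icc 1 ⌊w⌋₊ := by
              intro a ha
              have ha' := Finset.mem_filter.1 ha
              rw [Finset.mem_Icc]
              exact ⟨Nat.pos_of_ne_zero (Nat.ne_zero_of_mem_smoothNumbers (hASm a ha'.1)),
                Nat.le_floor ha'.2⟩
            have hcard := Finset.card_le_card hsub
            rw [Nat.card_Icc, Nat.add_sub_cancel] at hcard
            calc _ ≤ ((⌊w⌋₊ : ℕ) : ℝ) := by exact_mod_cast hcard
              _ ≤ w := Nat.floor_le (by linarith)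
      _ = _ := by ring
  have hhigh : ∑ a ∈ A.filter (fun a : ℕ => ¬ (a:ℝ) ≤ w), max (P a - Q a) 0 ≤
      2 * (∑ p ∈ K.primesBelow, Real.log p / p) / Real.log w := by
    rw [le_div_iff₀ hlw]
    have hle : ∀ a ∈ A.filter (fun a : ℕ => ¬ (a:ℝ) ≤ w), max (P a - Q a) 0 * Real.log w
        ≤ P a * Real.log a := by
      intro a ha
      have h2 := (Finset.mem_filter.1 ha).2
      have h3 := hQ0 a
      have h4 := hP0 a
      have : max (P a - Q a) 0 ≤ P a := max_le (by linarith) h4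
      push Not at h2
      gcongr
    rw [Finset.sum_mul]
    refine (Finset.sum_le_sum hle).trans ?_
    calc _ ≤ ∑ a ∈ A, P a * Real.log a := by
          apply Finset.sum_le_sum_of_subset_of_nonneg (Finset.filter_subset _ _)
          intro a _ _
          exact mul_nonneg (hP0 a) (Real.log_natCast_nonneg a)
      _ = x⁻¹ * ∑ n ∈ I, Real.log (sp K n) := by
          rw [Finset.sum_comp (fun a : ℕ => Real.log a) (sp K), Finset.mul_sum]
          apply Finset.sum_congr rfl
          intro a _
          simp only [hP, nsmul_eq_mul]
          ring
      _ ≤ x⁻¹ * (2 * ⌊x⌋₊ * ∑ p ∈ K.primesBelow, Real.log p / p) := by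
          gcongr
          exact sum_log_sp K _
      _ ≤ x⁻¹ * (2 * x * ∑ p ∈ K.primesBelow, Real.log p / p) := by
          have hMn : 0 ≤ ∑ p ∈ K.primesBelow, Real.log p / p :=
            Finset.sum_nonneg (fun p _ => div_nonneg (Real.log_natCast_nonneg p) (by positivity))
          gcongr
          exact Nat.floor_le hx0.le
      _ = _ := by field_simp
  linarith

theorem tk_low (u : ℕ → ℝ) (N : ℕ) (s : Finset ℕ) (hs : ∀ p ∈ s, p.Prime ∧ p * p ≤ N) :
    ∑ n ∈ Finset.Icc 1 N, (∑ p ∈ s, if p ∣ n then u p else 0)^2 ≤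
      N * (2 * (∑ p ∈ s, u p ^ 2 / p) + (∑ p ∈ s, u p / p)^2) := by
  set c : ℕ → ℕ → ℝ := fun p q => ∑ n ∈ Finset.Icc 1 N, if p ∣ n ∧ q ∣ n then (1:ℝ) else 0 with hc
  have h1 : ∑ n ∈ Finset.Icc 1 N, (∑ p ∈ s, if p ∣ n then u p else 0)^2
      = ∑ p ∈ s, ∑ q ∈ s, u p * u q * c p q := by
    simp_rw [sq, Finset.sum_mul_sum, hc, Finset.mul_sum]
    rw [Finset.sum_comm]
    apply Finset.sum_congr rfl
    intro p _
    rw [Finset.sum_comm]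
    apply Finset.sum_congr rfl
    intro q _
    apply Finset.sum_congr rfl
    intro n _
    by_cases ha : p ∣ n <;> by_cases hb : q ∣ n <;> simp [ha, hb]
  have h2 : ∀ p ∈ s, ∀ q ∈ s, u p * u q * c p q ≤ N * ((u p / p) * (u q / q)) + |u p| * |u q|
      + (if p = q then N * (u p ^ 2 / p) else 0) := by
    intro p hp q hq
    have hpp := (hs p hp).1
    have hqq := (hs q hq).1
    by_cases hpq : p = q
    · subst hpq
      rw [if_pos rfl]
      have hcc : c p p ≤ N / p := by
        have := aux_count_le N p
        simpa [hc] using this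
      have e1 : u p * u p * c p p ≤ N * (u p ^ 2 / p) := by
        calc u p * u p * c p p ≤ u p * u p * (N / p) := by
              apply mul_le_mul_of_nonneg_left hcc (mul_self_nonneg _)
          _ = _ := by ring
      have e2 : 0 ≤ N * ((u p / p) * (u p / p)) := by
        apply mul_nonneg (by positivity) (mul_self_nonneg _)
      have e3 : 0 ≤ |u p| * |u p| := by positivity
      linarith
    · rw [if_neg hpq, add_zero]
      have hco : Nat.Coprime p q := (Nat.coprime_primes hpp hqq).2 hpq
      have hcc := aux_count N (p*q) (by positivity) (Nat.mul_pos hpp.pos hqq.pos)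
      rw [Nat.floor_natCast] at hcc
      have hce : c p q = ∑ n ∈ Finset.Icc 1 N, if p * q ∣ n then (1:ℝ) else 0 := by
        simp only [hc]
        apply Finset.sum_congr rfl
        intro n _
        congr 1
        apply propext
        constructor
        · rintro ⟨a, b⟩; exact hco.mul_dvd_of_dvd_of_dvd a b
        · intro h; exact ⟨(Dvd.intro _ rfl).trans h, (Dvd.intro_left _ rfl).trans h⟩
      rw [← hce] at hcc
      have hp0 : (p:ℝ) ≠ 0 := by exact_mod_cast hpp.ne_zero
      have hq0 : (q:ℝ) ≠ 0 := by exact_mod_cast hqq.ne_zero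
      have e1 : u p * u q * c p q = N * ((u p / p) * (u q / q)) +
          u p * u q * (c p q - N / ((p * q : ℕ) : ℝ)) := by
        push_cast; field_simp; ring
      rw [e1]
      refine add_le_add le_rfl ?_
      calc _ ≤ |u p * u q * (c p q - N / ((p * q : ℕ) : ℝ))| := le_abs_self _
        _ = |u p| * |u q| * |c p q - N / ((p * q : ℕ) : ℝ)| := by rw [abs_mul, abs_mul]
        _ ≤ |u p| * |u q| * 1 := by gcongr
        _ = _ := mul_one _
  have h3 : (∑ p ∈ s, |u p|)^2 ≤ (∑ p ∈ s, u p ^ 2 / p) * N := by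
    have hcs := Finset.sum_sq_le_sum_mul_sum_of_sq_eq_mul s (r := fun p => |u p|)
      (f := fun p => u p ^ 2 / p) (g := fun p => (p:ℝ)) (fun p _ => by positivity)
      (fun p _ => by positivity) (fun p hp => by
        have hp0 : (p:ℝ) ≠ 0 := by exact_mod_cast (hs p hp).1.ne_zero
        rw [sq_abs]; field_simp)
    refine hcs.trans ?_
    have hB : 0 ≤ ∑ p ∈ s, u p ^ 2 / p := Finset.sum_nonneg (fun p _ => by positivity)
    gcongr
    have hle : ∀ p ∈ s, p ≤ Nat.sqrt N := fun p hp => Nat.le_sqrt.2 (hs p hp).2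
    have hsub : s ⊆ Finset.Icc 1 (Nat.sqrt N) := fun p hp =>
      Finset.mem_Icc.2 ⟨(hs p hp).1.pos, hle p hp⟩
    have hcard := Finset.card_le_card hsub
    rw [Nat.card_Icc, Nat.add_sub_cancel] at hcard
    have : ∑ p ∈ s, p ≤ N := by
      calc ∑ p ∈ s, p ≤ ∑ p ∈ s, Nat.sqrt N := Finset.sum_le_sum hle
        _ = s.card * Nat.sqrt N := by simp
        _ ≤ Nat.sqrt N * Nat.sqrt N := Nat.mul_le_mul_right _ hcard
        _ ≤ N := Nat.sqrt_le N
    calc (∑ p ∈ s, (p:ℝ)) = ((∑ p ∈ s, p : ℕ) : ℝ) := by push_cast; rfl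
      _ ≤ N := by exact_mod_cast this
  rw [h1]
  calc _ ≤ ∑ p ∈ s, ∑ q ∈ s, (N * ((u p / p) * (u q / q)) + |u p| * |u q|
      + (if p = q then N * (u p ^ 2 / p) else 0)) :=
        Finset.sum_le_sum (fun p hp => Finset.sum_le_sum (fun q hq => h2 p hp q hq))
    _ = N * (∑ p ∈ s, u p / p)^2 + (∑ p ∈ s, |u p|)^2 + N * ∑ p ∈ s, u p ^ 2 / p := by
        simp_rw [Finset.sum_add_distrib]
        congr 1
        · congr 1
          · rw [sq, Finset.sum_mul_sum, Finset.mul_sum]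
            simp_rw [Finset.mul_sum]
          · rw [sq, Finset.sum_mul_sum]
        · rw [Finset.mul_sum]
          apply Finset.sum_congr rfl
          intro p hp
          rw [Finset.sum_ite_eq, if_pos hp]
    _ ≤ _ := by linarith

theorem tk_high (u : ℕ → ℝ) (N : ℕ) (s : Finset ℕ) (hs : ∀ p ∈ s, p.Prime ∧ N < p * p) :
    ∑ n ∈ Finset.Icc 1 N, (∑ p ∈ s, if p ∣ n then u p else 0)^2 ≤
      N * (∑ p ∈ s, u p ^ 2 / p) := by
  have h1 : ∀ n ∈ Finset.Icc 1 N, (∑ p ∈ s, if p ∣ n then u p else 0)^2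
      = ∑ p ∈ s, u p ^ 2 * if p ∣ n then (1:ℝ) else 0 := by
    intro n hn
    rw [Finset.mem_Icc] at hn
    rw [sq, Finset.sum_mul_sum]
    apply Finset.sum_congr rfl
    intro p hp
    rw [Finset.sum_eq_single p]
    · split_ifs <;> ring
    · intro q hq hqp
      by_cases ha : p ∣ n <;> by_cases hb : q ∣ n <;> simp [ha, hb]
      exfalso
      have hco : Nat.Coprime p q := (Nat.coprime_primes (hs p hp).1 (hs q hq).1).2 (Ne.symm hqp)
      have hle : p * q ≤ N :=
        (Nat.le_of_dvd (by lia) (hco.mul_dvd_of_dvd_of_dvd ha hb)).trans hn.2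
      have h3 := (hs p hp).2
      have h4 := (hs q hq).2
      rcases le_total p q with h | h
      · have := Nat.mul_le_mul_left p h
        lia
      · have := Nat.mul_le_mul_right q h
        lia
    · intro h; exact absurd hp h
  rw [Finset.sum_congr rfl h1, Finset.sum_comm, Finset.mul_sum]
  apply Finset.sum_le_sum
  intro p hp
  rw [← Finset.mul_sum]
  calc _ ≤ u p ^ 2 * (N / p) := by
        gcongr; exact aux_count_le N p
    _ = _ := by ring

theorem tk (u : ℕ → ℝ) (N : ℕ) (s : Finset ℕ) (hs : ∀ p ∈ s, p.Prime) (A B : ℝ)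
    (hA : |∑ p ∈ s.filter (fun p => p * p ≤ N), u p / p| ≤ A)
    (hB : ∑ p ∈ s, u p ^ 2 / p ≤ B) :
    ∑ n ∈ Finset.Icc 1 N, (∑ p ∈ s, if p ∣ n then u p else 0)^2 ≤ N * (6 * B + 2 * A^2) := by
  set s1 := s.filter (fun p => p * p ≤ N) with hs1
  set s2 := s.filter (fun p => ¬ p * p ≤ N) with hs2
  have hsB : ∑ p ∈ s1, u p ^ 2 / p + ∑ p ∈ s2, u p ^ 2 / p = ∑ p ∈ s, u p ^ 2 / p :=
    Finset.sum_filter_add_sum_filter_not _ _ _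
  have hB1 : 0 ≤ ∑ p ∈ s1, u p ^ 2 / p := Finset.sum_nonneg (fun p _ => by positivity)
  have hB2 : 0 ≤ ∑ p ∈ s2, u p ^ 2 / p := Finset.sum_nonneg (fun p _ => by positivity)
  have l1 := tk_low u N s1 (fun p hp => ⟨hs p (Finset.mem_filter.1 hp).1, (Finset.mem_filter.1 hp).2⟩)
  have l2 := tk_high u N s2 (fun p hp => ⟨hs p (Finset.mem_filter.1 hp).1,
    not_le.1 (Finset.mem_filter.1 hp).2⟩)
  have hA2 : (∑ p ∈ s1, u p / p)^2 ≤ A^2 := by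
    rw [← sq_abs]; gcongr
  calc _ ≤ ∑ n ∈ Finset.Icc 1 N, (2 * (∑ p ∈ s1, if p ∣ n then u p else 0)^2 +
        2 * (∑ p ∈ s2, if p ∣ n then u p else 0)^2) := by
        apply Finset.sum_le_sum
        intro n _
        rw [← Finset.sum_filter_add_sum_filter_not s (fun p => p * p ≤ N)]
        have := sq_nonneg ((∑ p ∈ s1, if p ∣ n then u p else 0) - (∑ p ∈ s2, if p ∣ n then u p else 0))
        nlinarith
    _ = 2 * (∑ n ∈ Finset.Icc 1 N, (∑ p ∈ s1, if p ∣ n then u p else 0)^2) +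
        2 * (∑ n ∈ Finset.Icc 1 N, (∑ p ∈ s2, if p ∣ n then u p else 0)^2) := by
        rw [Finset.sum_add_distrib, Finset.mul_sum, Finset.mul_sum]
    _ ≤ 2 * (N * (2 * (∑ p ∈ s1, u p ^ 2 / p) + (∑ p ∈ s1, u p / p)^2)) +
        2 * (N * (∑ p ∈ s2, u p ^ 2 / p)) := by linarith
    _ = N * (4 * (∑ p ∈ s1, u p ^ 2 / p) + 2 * (∑ p ∈ s1, u p / p)^2 +
        2 * (∑ p ∈ s2, u p ^ 2 / p)) := by ring
    _ ≤ _ := by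
        apply mul_le_mul_of_nonneg_left _ (by positivity)
        linarith

/-- The truncated value `u(p)`. -/
def uu (f : ℕ → ℝ) (p : ℕ) : ℝ := if |f p| ≤ 1 then f p else 0

/-- The multiplicative function `exp(i τ f_R(n))`. -/
def GG (f : ℕ → ℝ) (R τ : ℝ) (n : ℕ) : ℂ := Complex.exp ((τ * fR f R n : ℝ) * Complex.I)

theorem uu_sq (f : ℕ → ℝ) (p : ℕ) : uu f p ^ 2 ≤ min 1 (f p ^ 2) := by
  unfold uu
  split_ifs with h
  · rw [min_eq_right]
    rw [← sq_abs]
    exact pow_le_one₀ (abs_nonneg _) h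
  · simp; positivity

theorem fR_one (f : ℕ → ℝ) (R : ℝ) : fR f R 1 = 0 := by simp [fR]

theorem fR_mul (f : ℕ → ℝ) (R : ℝ) (m n : ℕ) (h : Nat.Coprime m n) :
    fR f R (m * n) = fR f R m + fR f R n := by
  unfold fR
  rw [h.primeFactors_mul, Finset.sum_union h.disjoint_primeFactors]
  congr 1
  · apply Finset.sum_congr rfl
    intro p hp
    rw [Nat.factorization_eq_of_coprime_left h (by rwa [← Nat.mem_primeFactors_iff_mem_primeFactorsList])]
  · apply Finset.sum_congr rfl
    intro p hp
    rw [Nat.factorization_eq_of_coprime_right h (by rwa [← Nat.mem_primeFactors_iff_mem_primeFactorsList])]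

theorem fR_prime (f : ℕ → ℝ) (R : ℝ) (p : ℕ) (hp : p.Prime) (h : R < p) :
    fR f R p = uu f p := by
  unfold fR uu
  rw [hp.primeFactors, Finset.sum_singleton, hp.factorization_self, pow_one]
  simp [not_le.2 h]

theorem GG_one (f : ℕ → ℝ) (R τ : ℝ) : GG f R τ 1 = 1 := by simp [GG, fR_one]

theorem GG_norm (f : ℕ → ℝ) (R τ : ℝ) (n : ℕ) : ‖GG f R τ n‖ = 1 := Complex.norm_exp_ofReal_mul_I _

theorem GG_mul (f : ℕ → ℝ) (R τ : ℝ) (m n : ℕ) (h : Nat.Coprime m n) :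
    GG f R τ (m * n) = GG f R τ m * GG f R τ n := by
  unfold GG
  rw [fR_mul _ _ _ _ h, ← Complex.exp_add]
  congr 1
  push_cast
  ring

theorem fR_sp (f : ℕ → ℝ) (R : ℝ) (K N n : ℕ) (hR : R < K) (hn : n ∈ Finset.Icc 1 N)
    (hsq : ∀ p, p.Prime → K ≤ p → ¬ p ^ 2 ∣ n) :
    fR f R n = fR f R (sp K n) +
      ∑ p ∈ (Finset.Icc K N).filter Nat.Prime, if p ∣ n then uu f p else 0 := by
  rw [Finset.mem_Icc] at hn
  have hn0 : n ≠ 0 := by lia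
  have hco : Nat.Coprime (sp K n) (rp K n) := by
    rw [← Nat.disjoint_primeFactors (sp_ne_zero K n hn0) (rp_ne_zero K n hn0), sp_primeFactors, rp_primeFactors]
    exact Finset.disjoint_filter_filter_not _ _ _
  conv_lhs => rw [← sp_mul_rp K n hn0, fR_mul _ _ _ _ hco]
  congr 1
  have e : ((Finset.Icc K N).filter Nat.Prime).filter (fun p => p ∣ n) = (rp K n).primeFactors := by
    rw [rp_primeFactors]
    ext p
    simp only [Finset.mem_filter, Finset.mem_Icc, Nat.mem_primeFactors, not_lt]
    constructor
    · rintro ⟨⟨⟨a, b⟩, c⟩, d⟩; exact ⟨⟨c, d, hn0⟩, a⟩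
    · rintro ⟨⟨c, d, _⟩, a⟩; exact ⟨⟨⟨a, (Nat.le_of_dvd (by lia) d).trans hn.2⟩, c⟩, d⟩
  rw [← Finset.sum_filter, e]
  unfold fR
  apply Finset.sum_congr rfl
  intro p hp
  rw [rp_primeFactors, Finset.mem_filter, Nat.mem_primeFactors] at hp
  obtain ⟨⟨hp1, hp2, _⟩, hp3⟩ := hp
  have hpK : K ≤ p := by lia
  have hf : (rp K n).factorization p = 1 := by
    rw [rp_factorization]
    have h1 : n.factorization p = 1 := by
      apply le_antisymm
      · by_contra hh
        exact hsq p hp1 hpK ((hp1.pow_dvd_iff_le_factorization hn0).2 (by lia))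
      · exact (hp1.dvd_iff_one_le_factorization hn0).1 hp2
    simp [Finsupp.filter_apply, h1, hp3]
  rw [hf, pow_one]
  unfold uu
  have : ¬ (p:ℝ) ≤ R := by
    have : (K:ℝ) ≤ p := by exact_mod_cast hpK
    linarith
  simp [this]

theorem eta_nonneg {f : ℕ → ℝ} {η : ℝ → ℝ} (h : EtaBound f η) (y : ℝ) : 0 ≤ η y :=
  h.2.1.le_of_tendsto h.2.2.1 y

theorem summable_pp (f : ℕ → ℝ) (hf : EWConv f) (y : ℝ) :
    Summable (fun n : ℕ => if IsPrimePow n ∧ y < (n : ℝ) then min 1 (f n ^ 2) / (n : ℝ) else 0) := by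
  have h1 : Summable (fun n : ℕ => if n.Prime then min 1 (f n ^ 2) / (n : ℝ) else 0) := by
    have := hf.1
    have h2 := (summable_subtype_iff_indicator (s := {p : ℕ | p.Prime})
      (f := fun n : ℕ => min 1 (f n ^ 2) / (n:ℝ))).1 this
    convert h2 using 1
    ext n
    simp [Set.indicator]
  have h2 := (ArithmeticFunction.vonMangoldt.summable_residueClass_non_primes_div (q := 1) 0).mul_left
    (Real.log 2)⁻¹
  refine Summable.of_nonneg_of_le ?_ ?_ (h1.add h2)
  · intro n
    split_ifs
    · positivity
    · exact le_rfl
  · intro n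
    have hl : 0 < Real.log 2 := Real.log_pos (by norm_num)
    have hr : ArithmeticFunction.vonMangoldt.residueClass (0 : ZMod 1) n = ArithmeticFunction.vonMangoldt n := by
      simp [ArithmeticFunction.vonMangoldt.residueClass, Set.indicator]
      intro h; exact absurd (Subsingleton.elim _ _) h
    rw [hr]
    have hL : 0 ≤ ArithmeticFunction.vonMangoldt n := ArithmeticFunction.vonMangoldt_nonneg
    by_cases hp : n.Prime
    · simp only [hp, if_true, zero_div, mul_zero, add_zero]
      split_ifs
      · exact le_rfl
      · positivity
    · simp only [hp, if_false, zero_add]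
      split_ifs with hc
      · have hL2 : Real.log 2 ≤ ArithmeticFunction.vonMangoldt n := by
          rw [ArithmeticFunction.vonMangoldt_apply, if_pos hc.1]
          apply Real.log_le_log (by norm_num)
          exact_mod_cast (Nat.minFac_prime hc.1.one_lt.ne').two_le
        rw [← mul_div_assoc]
        gcongr
        calc min 1 (f n ^ 2) ≤ 1 := min_le_left _ _
          _ = (Real.log 2)⁻¹ * Real.log 2 := (inv_mul_cancel₀ hl.ne').symm
          _ ≤ _ := by gcongr
      · positivity

theorem sumB (f : ℕ → ℝ) (η : ℝ → ℝ) (hf : EWConv f) (hη : EtaBound f η) (y : ℝ) (hy : 1 ≤ y)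
    (s : Finset ℕ) (hs : ∀ p ∈ s, p.Prime ∧ y < (p:ℝ)) :
    ∑ p ∈ s, uu f p ^ 2 / p ≤ η y := by
  refine le_trans ?_ (hη.2.2.2.2 y hy)
  refine le_trans ?_ ((summable_pp f hf y).sum_le_tsum s ?_)
  · apply Finset.sum_le_sum
    intro p hp
    rw [if_pos ⟨(hs p hp).1.isPrimePow, (hs p hp).2⟩]
    gcongr
    exact uu_sq f p
  · intro n _
    split_ifs
    · positivity
    · exact le_rfl

theorem sumA (f : ℕ → ℝ) (η : ℝ → ℝ) (hη : EtaBound f η) (y : ℝ) (hy : 1 ≤ y) (M : ℕ) :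
    |∑ p ∈ (Finset.range M).filter (fun p : ℕ => p.Prime ∧ y < (p:ℝ)), uu f p / p| ≤ 2 * η y := by
  have h0 := eta_nonneg hη y
  have key : ∀ (z : ℝ) (N : ℕ),
    ∑ p ∈ (Finset.range N).filter (fun p => Nat.Prime p ∧ z < (p : ℝ) ∧ |f p| ≤ 1), f p / (p : ℝ)
     = ∑ p ∈ (Finset.range N).filter (fun p : ℕ => p.Prime ∧ z < (p:ℝ)), uu f p / p := by
    intro z N
    have : (Finset.range N).filter (fun p => Nat.Prime p ∧ z < (p : ℝ) ∧ |f p| ≤ 1)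
      = ((Finset.range N).filter (fun p => Nat.Prime p ∧ z < (p : ℝ))).filter (fun p => |f p| ≤ 1) := by
      rw [Finset.filter_filter]
      congr 1; ext p; tauto
    rw [this, Finset.sum_filter]
    apply Finset.sum_congr rfl
    intro p _
    unfold uu
    split_ifs <;> simp
  by_cases hM : (M:ℝ) - 1 ≤ y
  · rw [Finset.filter_false_of_mem]
    · simp [h0]
    · intro p hp
      rw [Finset.mem_range] at hp
      have : (p:ℝ) + 1 ≤ M := by exact_mod_cast hp
      intro h; linarith [h.2]
  · push Not at hM
    obtain ⟨l1, hl1, hl1'⟩ := hη.2.2.2.1 y hy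
    obtain ⟨l2, hl2, hl2'⟩ := hη.2.2.2.1 ((M:ℝ)-1) (hy.trans hM.le)
    have hd := hl1.sub hl2
    have hc : ∑ p ∈ (Finset.range M).filter (fun p : ℕ => p.Prime ∧ y < (p:ℝ)), uu f p / p = l1 - l2 := by
      refine tendsto_nhds_unique (Tendsto.congr' ?_ tendsto_const_nhds) hd
      filter_upwards [Filter.eventually_ge_atTop M] with N hN
      rw [key, key, eq_sub_iff_add_eq, ← Finset.sum_union]
      · apply Finset.sum_congr _ (fun _ _ => rfl)
        ext p
        simp only [Finset.mem_union, Finset.mem_filter, Finset.mem_range]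
        have hiff : (M:ℝ) - 1 < p ↔ M ≤ p := by
          constructor
          · intro h
            have : (M:ℝ) < p + 1 := by linarith
            have : M < p + 1 := by exact_mod_cast this
            lia
          · intro h
            have : (M:ℝ) ≤ p := by exact_mod_cast h
            linarith
        constructor
        · rintro (⟨a, b, c⟩ | ⟨a, b, c⟩)
          · exact ⟨by lia, b, c⟩
          · exact ⟨a, b, hM.trans c⟩
        · rintro ⟨a, b, c⟩
          rw [hiff]
          by_cases h : p < M
          · exact Or.inl ⟨h, b, c⟩
          · exact Or.inr ⟨a, b, by lia⟩
      · rw [Finset.disjoint_left]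
        intro p hp hq
        rw [Finset.mem_filter, Finset.mem_range] at hp hq
        have : (p:ℝ) + 1 ≤ M := by exact_mod_cast hp.1
        linarith [hq.2.2]
    rw [hc]
    calc |l1 - l2| ≤ |l1| + |l2| := abs_sub _ _
      _ ≤ η y + η ((M:ℝ)-1) := add_le_add hl1' hl2'
      _ ≤ η y + η y := by gcongr; exact hη.2.1 hM.le
      _ = _ := by ring

theorem exp_lip (a b : ℝ) :
    ‖Complex.exp ((a:ℝ) * Complex.I) - Complex.exp ((b:ℝ) * Complex.I)‖ ≤ |a - b| := by
  have : Complex.exp ((a:ℝ) * Complex.I) - Complex.exp ((b:ℝ) * Complex.I)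
      = Complex.exp ((b:ℝ) * Complex.I) * (Complex.exp (Complex.I * ((a - b : ℝ):ℂ)) - 1) := by
    rw [mul_sub, ← Complex.exp_add, mul_one]
    congr 2
    push_cast; ring
  rw [this, norm_mul, Complex.norm_exp_ofReal_mul_I, one_mul]
  exact Real.norm_exp_I_mul_ofReal_sub_one_le

theorem sum_inv_sq_ge (K N : ℕ) (hK : 1 ≤ K) :
    ∑ p ∈ (Finset.Icc K N).filter Nat.Prime, 1 / (p:ℝ)^2 ≤ 2 / (K:ℝ) := by
  have h := sum_Ioo_inv_sq_le (α := ℝ) (K - 1) (N + 1)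
  have hc : (((K - 1 : ℕ) : ℝ) + 1) = K := by
    have : K - 1 + 1 = K := by lia
    exact_mod_cast this
  rw [hc] at h
  refine le_trans ?_ h
  simp_rw [one_div]
  apply Finset.sum_le_sum_of_subset_of_nonneg
  · intro p hp
    simp only [Finset.mem_filter, Finset.mem_Icc, Finset.mem_Ioo] at hp ⊢
    lia
  · intros; positivity

theorem step1 (f : ℕ → ℝ) (η : ℝ → ℝ) (hf : EWConv f) (hη : EtaBound f η) (R T τ y : ℝ) (K N : ℕ)
    (hy : 1 ≤ y) (hK : ∀ p : ℕ, K ≤ p ↔ y < p) (hR : R < K) (hK1 : 1 ≤ K) (hτ : |τ| ≤ T) :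
    ∑ n ∈ Finset.Icc 1 N, ‖GG f R τ n - GG f R τ (sp K n)‖ ≤
      N * (4 / K + T * Real.sqrt (6 * η y + 8 * η y ^ 2)) := by
  set s := (Finset.Icc K N).filter Nat.Prime with hs
  have hT : 0 ≤ T := (abs_nonneg τ).trans hτ
  have hη0 := eta_nonneg hη y
  set F : ℕ → ℝ := fun n => ∑ p ∈ s, if p ∣ n then uu f p else 0 with hF
  have hpt : ∀ n ∈ Finset.Icc 1 N, ‖GG f R τ n - GG f R τ (sp K n)‖ ≤
      T * |F n| + ∑ p ∈ s, 2 * (if p ^ 2 ∣ n then (1:ℝ) else 0) := by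
    intro n hn
    have hnn : 0 ≤ ∑ p ∈ s, 2 * (if p ^ 2 ∣ n then (1:ℝ) else 0) :=
      Finset.sum_nonneg (fun p _ => by split_ifs <;> norm_num)
    by_cases hsq : ∀ p, p.Prime → K ≤ p → ¬ p ^ 2 ∣ n
    · have h1 := fR_sp f R K N n hR hn hsq
      have h2 := exp_lip (τ * fR f R n) (τ * fR f R (sp K n))
      have h3 : τ * fR f R n - τ * fR f R (sp K n) = τ * F n := by rw [h1]; ring
      rw [h3, abs_mul] at h2
      have h4 : |τ| * |F n| ≤ T * |F n| := by gcongr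
      unfold GG
      linarith
    · push Not at hsq
      obtain ⟨p, hp, hpK, hpn⟩ := hsq
      rw [Finset.mem_Icc] at hn
      have hps : p ∈ s := by
        rw [hs, Finset.mem_filter, Finset.mem_Icc]
        refine ⟨⟨hpK, ?_⟩, hp⟩
        exact (Nat.le_of_dvd (by lia) ((dvd_pow_self p two_ne_zero).trans hpn)).trans hn.2
      have h1 : (2:ℝ) ≤ ∑ p ∈ s, 2 * (if p ^ 2 ∣ n then (1:ℝ) else 0) := by
        calc (2:ℝ) = 2 * (if p ^ 2 ∣ n then (1:ℝ) else 0) := by rw [if_pos hpn, mul_one]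
          _ ≤ _ := Finset.single_le_sum (f := fun p => 2 * (if p ^ 2 ∣ n then (1:ℝ) else 0))
            (fun p _ => by split_ifs <;> norm_num) hps
      have h2 : ‖GG f R τ n - GG f R τ (sp K n)‖ ≤ 2 := by
        refine (norm_sub_le _ _).trans ?_
        rw [GG_norm, GG_norm]; norm_num
      have h3 : 0 ≤ T * |F n| := by positivity
      linarith
  have hsq : ∑ n ∈ Finset.Icc 1 N, ∑ p ∈ s, 2 * (if p ^ 2 ∣ n then (1:ℝ) else 0) ≤ (N:ℝ) * (4 / (K:ℝ)) := by
    rw [Finset.sum_comm]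
    calc _ ≤ ∑ p ∈ s, (2 * (N:ℝ)) * (1 / (p:ℝ)^2) := by
          apply Finset.sum_le_sum
          intro p hp
          rw [← Finset.mul_sum]
          have := aux_count_le N (p^2)
          push_cast at this
          calc _ ≤ 2 * (N / (p:ℝ)^2) := by gcongr
            _ = _ := by ring
      _ ≤ (2 * (N:ℝ)) * (2 / (K:ℝ)) := by
          rw [← Finset.mul_sum]
          gcongr
          exact sum_inv_sq_ge K N hK1
      _ = _ := by ring
  have hFs : ∑ n ∈ Finset.Icc 1 N, F n ^ 2 ≤ N * (6 * η y + 2 * (2 * η y)^2) := by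
    apply tk (uu f) N s (fun p hp => (Finset.mem_filter.1 hp).2)
    · have := sumA f η hη y hy (Nat.sqrt N + 1)
      convert this using 2
      apply Finset.sum_congr _ (fun _ _ => rfl)
      ext p
      simp only [hs, Finset.mem_filter, Finset.mem_Icc, Finset.mem_range]
      rw [← hK p, Nat.lt_succ_iff, Nat.le_sqrt]
      constructor
      · rintro ⟨⟨⟨a, b⟩, c⟩, d⟩; exact ⟨d, c, a⟩
      · rintro ⟨d, c, a⟩; exact ⟨⟨⟨a, (Nat.le_mul_self p).trans d⟩, c⟩, d⟩
    · apply sumB f η hf hη y hy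
      intro p hp
      rw [hs, Finset.mem_filter, Finset.mem_Icc] at hp
      exact ⟨hp.2, (hK p).1 hp.1.1⟩
  have hFa : ∑ n ∈ Finset.Icc 1 N, |F n| ≤ N * Real.sqrt (6 * η y + 8 * η y ^ 2) := by
    have h1 := sq_sum_le_card_mul_sum_sq (s := Finset.Icc 1 N) (f := fun n => |F n|)
    simp only [sq_abs, Nat.card_Icc, Nat.add_sub_cancel] at h1
    have h2 : (∑ n ∈ Finset.Icc 1 N, |F n|)^2 ≤ (N:ℝ)^2 * (6 * η y + 8 * η y ^ 2) := by
      refine h1.trans ?_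
      calc _ ≤ (N:ℝ) * (N * (6 * η y + 2 * (2 * η y)^2)) := by gcongr
        _ = _ := by ring
    have h3 := Real.abs_le_sqrt h2
    rw [Real.sqrt_mul (by positivity), Real.sqrt_sq (by positivity)] at h3
    exact (le_abs_self _).trans h3
  calc _ ≤ ∑ n ∈ Finset.Icc 1 N, (T * |F n| + ∑ p ∈ s, 2 * (if p ^ 2 ∣ n then (1:ℝ) else 0)) :=
        Finset.sum_le_sum hpt
    _ = T * ∑ n ∈ Finset.Icc 1 N, |F n| +
        ∑ n ∈ Finset.Icc 1 N, ∑ p ∈ s, 2 * (if p ^ 2 ∣ n then (1:ℝ) else 0) := by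
        rw [Finset.sum_add_distrib, Finset.mul_sum]
    _ ≤ T * (N * Real.sqrt (6 * η y + 8 * η y ^ 2)) + N * (4 / K) := by gcongr
    _ = _ := by ring

theorem exp_second (t : ℝ) : ‖Complex.exp ((t:ℝ) * Complex.I) - 1 - (t:ℝ) * Complex.I‖ ≤ 2 * t ^ 2 := by
  by_cases h : |t| ≤ 1
  · have h1 : ‖(t:ℂ) * Complex.I‖ = |t| := by simp
    have := Complex.norm_exp_sub_one_sub_id_le (x := (t:ℂ) * Complex.I) (by rw [h1]; exact h)
    rw [h1, sq_abs] at this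
    nlinarith [sq_nonneg t]
  · push Not at h
    have h1 : ‖(t:ℂ) * Complex.I‖ = |t| := by simp
    have h2 : ‖Complex.exp ((t:ℝ) * Complex.I) - 1‖ ≤ |t| := by
      have := exp_lip t 0
      simpa using this
    have h3 := norm_sub_le (Complex.exp ((t:ℝ) * Complex.I) - 1) ((t:ℝ) * Complex.I)
    have h4 : |t| ≤ t ^ 2 := by rw [← sq_abs]; nlinarith
    rw [h1] at h3
    linarith

theorem prod_diff (s : Finset ℕ) (a b : ℕ → ℂ) (ha : ∀ p ∈ s, ‖a p‖ ≤ 1) (hb : ∀ p ∈ s, ‖b p‖ ≤ 1) :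
    ‖∏ p ∈ s, a p - ∏ p ∈ s, b p‖ ≤ ∑ p ∈ s, ‖a p - b p‖ := by
  induction s using Finset.induction_on with
  | empty => simp
  | insert q s hq ih =>
    rw [Finset.prod_insert hq, Finset.prod_insert hq, Finset.sum_insert hq]
    have ih' := ih (fun p hp => ha p (Finset.mem_insert_of_mem hp)) (fun p hp => hb p (Finset.mem_insert_of_mem hp))
    have hb1 : ‖∏ p ∈ s, b p‖ ≤ 1 := by
      rw [norm_prod]
      exact Finset.prod_le_one (fun _ _ => norm_nonneg _) (fun p hp => hb p (Finset.mem_insert_of_mem hp))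
    have haq := ha q (Finset.mem_insert_self _ _)
    have e : a q * ∏ p ∈ s, a p - b q * ∏ p ∈ s, b p
      = a q * (∏ p ∈ s, a p - ∏ p ∈ s, b p) + (a q - b q) * ∏ p ∈ s, b p := by ring
    rw [e]
    refine (norm_add_le _ _).trans ?_
    rw [norm_mul, norm_mul]
    have h1 : ‖a q‖ * ‖∏ p ∈ s, a p - ∏ p ∈ s, b p‖ ≤ 1 * ∑ p ∈ s, ‖a p - b p‖ := by gcongr
    have h2 : ‖a q - b q‖ * ‖∏ p ∈ s, b p‖ ≤ ‖a q - b q‖ * 1 := by gcongr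
    linarith

theorem local_factor (g : ℕ → ℂ) (h0 : g 0 = 1) (hg : ∀ ν, ‖g ν‖ ≤ 1) (p : ℕ) (hp : 2 ≤ p) :
    ‖(1 - 1/(p:ℂ)) * ∑' ν : ℕ, g ν / (p:ℂ)^ν‖ ≤ 1 ∧
    ‖(1 - 1/(p:ℂ)) * (∑' ν : ℕ, g ν / (p:ℂ)^ν) - (1 + (g 1 - 1) / p)‖ ≤ 2 / (p:ℝ)^2 := by
  have hp2 : (2:ℝ) ≤ p := by exact_mod_cast hp
  have hp0 : (0:ℝ) < p := by linarith
  set r : ℝ := 1 / (p:ℝ) with hr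
  have hr0 : 0 < r := by positivity
  have hr1 : r < 1 := by rw [hr, div_lt_one hp0]; linarith
  have hgs : Summable (fun ν : ℕ => r ^ ν) := summable_geometric_of_lt_one hr0.le hr1
  have hb : ∀ ν : ℕ, ‖g ν / (p:ℂ)^ν‖ ≤ r ^ ν := by
    intro ν
    rw [norm_div, norm_pow, Complex.norm_natCast, hr, one_div_pow]
    gcongr
    exact hg ν
  have hs : Summable (fun ν : ℕ => g ν / (p:ℂ)^ν) := Summable.of_norm_bounded hgs hb
  have hn : ‖(1 - 1/(p:ℂ))‖ = 1 - r := by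
    have : (1 - 1/(p:ℂ)) = ((1 - r : ℝ) : ℂ) := by rw [hr]; push_cast; ring
    rw [this, Complex.norm_real, Real.norm_of_nonneg (by linarith)]
  constructor
  · rw [norm_mul, hn]
    have h1 : ‖∑' ν : ℕ, g ν / (p:ℂ)^ν‖ ≤ (1 - r)⁻¹ := by
      rw [← tsum_geometric_of_lt_one hr0.le hr1]
      exact tsum_of_norm_bounded hgs.hasSum hb
    calc (1 - r) * ‖∑' ν : ℕ, g ν / (p:ℂ)^ν‖ ≤ (1 - r) * (1 - r)⁻¹ := by
          apply mul_le_mul_of_nonneg_left h1; linarith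
      _ = 1 := mul_inv_cancel₀ (by linarith)
  · set t := ∑' ν : ℕ, g (ν + 2) / (p:ℂ)^(ν + 2) with ht
    have h1 : ∑' ν : ℕ, g ν / (p:ℂ)^ν = 1 + g 1 / p + t := by
      rw [← hs.sum_add_tsum_nat_add 2]
      simp [Finset.sum_range_succ, h0, ht]
    have h2 : ‖t‖ ≤ r ^ 2 * (1 - r)⁻¹ := by
      have : HasSum (fun ν : ℕ => r ^ 2 * r ^ ν) (r ^ 2 * (1 - r)⁻¹) :=
        (hasSum_geometric_of_lt_one hr0.le hr1).mul_left _
      refine tsum_of_norm_bounded this ?_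
      intro ν
      refine (hb (ν + 2)).trans ?_
      rw [pow_add, mul_comm]
    have hpc : (p:ℂ) ≠ 0 := by
      have : p ≠ 0 := by lia
      exact_mod_cast this
    have e : (1 - 1/(p:ℂ)) * (∑' ν : ℕ, g ν / (p:ℂ)^ν) - (1 + (g 1 - 1) / p)
        = (1 - 1/(p:ℂ)) * t - g 1 / (p:ℂ)^2 := by
      rw [h1]; field_simp; ring
    rw [e]
    refine (norm_sub_le _ _).trans ?_
    rw [norm_mul, hn, norm_div, norm_pow, Complex.norm_natCast]
    have h3 : (1 - r) * ‖t‖ ≤ 1 / (p:ℝ)^2 := by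
      calc (1 - r) * ‖t‖ ≤ (1 - r) * (r ^ 2 * (1 - r)⁻¹) := by
            apply mul_le_mul_of_nonneg_left h2; linarith
        _ = r ^ 2 := by
            have : 1 - r ≠ 0 := by linarith
            field_simp
        _ = _ := by rw [hr, one_div_pow]
    have h4 : ‖g 1‖ / (p:ℝ)^2 ≤ 1 / (p:ℝ)^2 := by
      gcongr; exact hg 1
    calc _ ≤ 1 / (p:ℝ)^2 + 1 / (p:ℝ)^2 := add_le_add h3 h4
      _ = _ := by ring

def kap (f : ℕ → ℝ) (R τ : ℝ) (p : ℕ) : ℂ :=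
  (1 - 1/(p:ℂ)) * ∑' ν : ℕ, GG f R τ (p ^ ν) / (p:ℂ)^ν

theorem kap_norm (f : ℕ → ℝ) (R τ : ℝ) (p : ℕ) (hp : p.Prime) : ‖kap f R τ p‖ ≤ 1 :=
  (local_factor (fun ν => GG f R τ (p ^ ν)) (by simp [GG_one]) (fun ν => (GG_norm _ _ _ _).le) p hp.two_le).1

theorem kap_approx (f : ℕ → ℝ) (R T τ : ℝ) (hτ : |τ| ≤ T) (p : ℕ) (hp : p.Prime) (hR : R < p) :
    ‖kap f R τ p - Complex.exp ((τ * (uu f p / p) : ℝ) * Complex.I)‖ ≤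
      4 * T ^ 2 * (uu f p ^ 2 / p) + 2 * (1 / (p:ℝ)^2) := by
  have h1 := (local_factor (fun ν => GG f R τ (p ^ ν)) (by simp [GG_one])
    (fun ν => (GG_norm _ _ _ _).le) p hp.two_le).2
  simp only [pow_one] at h1
  change ‖kap f R τ p - _‖ ≤ _ at h1
  set θ : ℝ := τ * uu f p with hθ
  have hG : GG f R τ p = Complex.exp ((θ:ℝ) * Complex.I) := by
    unfold GG; rw [fR_prime f R p hp hR]
  rw [hG] at h1
  have hp2 : (2:ℝ) ≤ p := by exact_mod_cast hp.two_le
  have hp0 : (0:ℝ) < p := by linarith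
  have hpc : (p:ℂ) ≠ 0 := by exact_mod_cast hp.ne_zero
  have e2 : τ * (uu f p / p) = θ / p := by rw [hθ]; ring
  rw [e2]
  have h2 := exp_second θ
  have h3 := exp_second (θ / p)
  set E := Complex.exp ((θ:ℝ) * Complex.I)
  set E' := Complex.exp ((θ / p : ℝ) * Complex.I)
  have e : kap f R τ p - E' = (kap f R τ p - (1 + (E - 1) / p)) + (E - 1 - (θ:ℝ) * Complex.I) / p
      - (E' - 1 - (θ / p : ℝ) * Complex.I) := by
    push_cast; field_simp; ring
  rw [e]
  refine (norm_sub_le _ _).trans ?_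
  have h4 := norm_add_le (kap f R τ p - (1 + (E - 1) / p)) ((E - 1 - (θ:ℝ) * Complex.I) / p)
  have h5 : ‖(E - 1 - (θ:ℝ) * Complex.I) / p‖ ≤ 2 * (θ ^ 2 / p) := by
    rw [norm_div, Complex.norm_natCast, ← mul_div_assoc]
    gcongr
  have h6 : (θ / p) ^ 2 ≤ θ ^ 2 / p := by
    rw [div_pow, sq (p:ℝ)]
    gcongr
    nlinarith
  have h7 : θ ^ 2 / p ≤ T ^ 2 * (uu f p ^ 2 / p) := by
    rw [← mul_div_assoc, hθ, mul_pow]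
    have hsq : τ ^ 2 ≤ T ^ 2 := sq_le_sq' (by linarith [neg_abs_le τ]) ((le_abs_self τ).trans hτ)
    exact div_le_div_of_nonneg_right (mul_le_mul_of_nonneg_right hsq (sq_nonneg _)) hp0.le
  have h8 : 2 / (p:ℝ)^2 = 2 * (1 / (p:ℝ)^2) := by ring
  linarith

theorem step3 (f : ℕ → ℝ) (η : ℝ → ℝ) (hf : EWConv f) (hη : EtaBound f η) (R T τ y : ℝ) (K : ℕ)
    (hy : 1 ≤ y) (hK : ∀ p : ℕ, K ≤ p ↔ y < p) (hR : R < K) (hK1 : 1 ≤ K) (hτ : |τ| ≤ T)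
    (φτ : ℂ) (hφ : Tendsto (fun N : ℕ => ∏ p ∈ (Finset.range N).filter Nat.Prime, kap f R τ p)
      atTop (𝓝 φτ)) :
    ‖∏ p ∈ K.primesBelow, kap f R τ p - φτ‖ ≤ 4 * T ^ 2 * η y + 4 / K + 2 * T * η y := by
  have hT : 0 ≤ T := (abs_nonneg τ).trans hτ
  have h0 := eta_nonneg hη y
  refine le_of_tendsto (tendsto_const_nhds.sub hφ).norm ?_
  filter_upwards [Filter.eventually_ge_atTop K] with M hM
  set s := (Finset.range M).filter (fun p : ℕ => p.Prime ∧ y < (p:ℝ)) with hs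
  have hsp : ∀ p ∈ s, p.Prime ∧ y < (p:ℝ) := fun p hp => (Finset.mem_filter.1 hp).2
  have hspl : ∏ p ∈ (Finset.range M).filter Nat.Prime, kap f R τ p
      = (∏ p ∈ K.primesBelow, kap f R τ p) * ∏ p ∈ s, kap f R τ p := by
    rw [← Finset.prod_union]
    · apply Finset.prod_congr _ (fun _ _ => rfl)
      ext p
      simp only [hs, Finset.mem_union, Finset.mem_filter, Finset.mem_range, Nat.mem_primesBelow, ← hK]
      constructor
      · rintro ⟨a, b⟩
        by_cases h : p < K
        · exact Or.inl ⟨h, b⟩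
        · exact Or.inr ⟨a, b, by lia⟩
      · rintro (⟨a, b⟩ | ⟨a, b, c⟩)
        · exact ⟨by lia, b⟩
        · exact ⟨a, b⟩
    · rw [Finset.disjoint_left]
      intro p hp hq
      rw [Nat.mem_primesBelow] at hp
      have := (hK p).2 (hsp p hq).2
      lia
  rw [hspl]
  have hP : ‖∏ p ∈ K.primesBelow, kap f R τ p‖ ≤ 1 := by
    rw [norm_prod]
    exact Finset.prod_le_one (fun _ _ => norm_nonneg _)
      (fun p hp => kap_norm f R τ p (Nat.mem_primesBelow.1 hp).2)
  have hd := prod_diff s (kap f R τ) (fun p => Complex.exp ((τ * (uu f p / p) : ℝ) * Complex.I))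
    (fun p hp => kap_norm f R τ p (hsp p hp).1) (fun p _ => (Complex.norm_exp_ofReal_mul_I _).le)
  have hd2 : ∑ p ∈ s, ‖kap f R τ p - Complex.exp ((τ * (uu f p / p) : ℝ) * Complex.I)‖ ≤
      4 * T ^ 2 * η y + 4 / K := by
    calc _ ≤ ∑ p ∈ s, (4 * T ^ 2 * (uu f p ^ 2 / p) + 2 * (1 / (p:ℝ)^2)) := by
          apply Finset.sum_le_sum
          intro p hp
          apply kap_approx f R T τ hτ p (hsp p hp).1
          have : (K:ℝ) ≤ p := by exact_mod_cast (hK p).2 (hsp p hp).2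
          linarith
      _ = 4 * T ^ 2 * (∑ p ∈ s, uu f p ^ 2 / p) + 2 * ∑ p ∈ s, 1 / (p:ℝ)^2 := by
          rw [Finset.sum_add_distrib, Finset.mul_sum, Finset.mul_sum]
      _ ≤ 4 * T ^ 2 * η y + 2 * (2 / (K:ℝ)) := by
          have hB := sumB f η hf hη y hy s hsp
          have hI : ∑ p ∈ s, 1 / (p:ℝ)^2 ≤ 2 / (K:ℝ) := by
            refine le_trans ?_ (sum_inv_sq_ge K M hK1)
            apply Finset.sum_le_sum_of_subset_of_nonneg
            · intro p hp
              rw [Finset.mem_filter, Finset.mem_Icc]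
              have := Finset.mem_range.1 (Finset.mem_filter.1 hp).1
              exact ⟨⟨(hK p).2 (hsp p hp).2, by lia⟩, (hsp p hp).1⟩
            · intros; positivity
          gcongr
      _ = _ := by ring
  have hE : ‖∏ p ∈ s, Complex.exp ((τ * (uu f p / p) : ℝ) * Complex.I) - 1‖ ≤ 2 * T * η y := by
    rw [← Complex.exp_sum, ← Finset.sum_mul, ← Complex.ofReal_sum, ← Finset.mul_sum]
    have h1 := exp_lip (τ * ∑ p ∈ s, uu f p / p) 0
    simp only [Complex.ofReal_zero, zero_mul, Complex.exp_zero, sub_zero] at h1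
    refine h1.trans ?_
    rw [abs_mul]
    have hA := sumA f η hη y hy M
    calc |τ| * |∑ p ∈ s, uu f p / p| ≤ T * (2 * η y) := by gcongr
      _ = _ := by ring
  have e : ∏ p ∈ K.primesBelow, kap f R τ p - (∏ p ∈ K.primesBelow, kap f R τ p) * ∏ p ∈ s, kap f R τ p
     = (∏ p ∈ K.primesBelow, kap f R τ p) * (1 - ∏ p ∈ s, kap f R τ p) := by ring
  rw [e, norm_mul]
  have h9 : ‖1 - ∏ p ∈ s, kap f R τ p‖ ≤ 4 * T ^ 2 * η y + 4 / K + 2 * T * η y := by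
    rw [norm_sub_rev]
    have := norm_add_le (∏ p ∈ s, kap f R τ p - ∏ p ∈ s, Complex.exp ((τ * (uu f p / p) : ℝ) * Complex.I))
      (∏ p ∈ s, Complex.exp ((τ * (uu f p / p) : ℝ) * Complex.I) - 1)
    rw [sub_add_sub_cancel] at this
    linarith
  calc _ ≤ 1 * ‖1 - ∏ p ∈ s, kap f R τ p‖ := by gcongr
    _ ≤ _ := by rw [one_mul]; exact h9

theorem step2 (f : ℕ → ℝ) (R τ x ε : ℝ) (hx : 3 ≤ x) (hε0 : 0 < ε) (hε : ε ≤ 1/400)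
    (hL : 1 ≤ ε ^ 2 * Real.log x) :
    ‖((x)⁻¹ : ℝ) * (∑ n ∈ Finset.Icc 1 ⌊x⌋₊, GG f R τ (sp (⌊x ^ ε⌋₊ + 1) n)) -
      ∏ p ∈ (⌊x ^ ε⌋₊ + 1).primesBelow, kap f R τ p‖ ≤ 410 * ε := by
  set L := Real.log x with hLdef
  have hx0 : 0 < x := by linarith
  have hxe : x = Real.exp L := (Real.exp_log hx0).symm
  have hε2 : ε ^ 2 ≤ ε / 400 := by nlinarith
  have hε3 : ε ^ 2 ≤ 1 / 160000 := by nlinarith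
  have hL1 : 160000 ≤ L := by
    by_contra h
    push Not at h
    have : ε ^ 2 * L < 1 := by
      rcases le_or_gt L 0 with h0 | h0
      · nlinarith [sq_nonneg ε]
      · nlinarith
    linarith
  have hL0 : 0 < L := by linarith
  have hinv : 1 / L ≤ ε ^ 2 := by rw [div_le_iff₀ hL0]; exact hL
  set N := ⌊x ^ ε⌋₊ with hN
  set z := ⌊Real.exp (L / 24)⌋₊ with hz
  have hz1 : (z:ℝ) ≤ Real.exp (L / 24) := Nat.floor_le (Real.exp_pos _).le
  have hz2 : Real.exp (L / 48) ≤ z := by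
    have h1 : Real.exp (L / 24) < z + 1 := Nat.lt_floor_add_one _
    have h2 : Real.exp (L / 24) = Real.exp (L / 48) * Real.exp (L / 48) := by
      rw [← Real.exp_add]; congr 1; ring
    have h3 : 2 ≤ Real.exp (L / 48) := by
      have := Real.add_one_le_exp (L / 48)
      linarith
    nlinarith
  have hz3 : (2:ℝ) ≤ z := by
    have := Real.add_one_le_exp (L / 48)
    linarith
  have hz4 : 1 < z := by
    have : (1:ℝ) < z := by linarith
    exact_mod_cast this
  have hlz : L / 48 ≤ Real.log z := by
    rw [Real.le_log_iff_exp_le (by linarith)]; exact hz2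
  set M := ∑ p ∈ (N + 1).primesBelow, Real.log p / p with hM
  have hy1 : 1 ≤ x ^ ε := Real.one_le_rpow (by linarith) hε0.le
  have hN1 : 1 ≤ N := Nat.le_floor (by simpa using hy1)
  have hM1 : M ≤ 2 * (ε * L) := by
    refine (aux_mertens N hN1).trans ?_
    have hN0 : (0:ℝ) < N := by exact_mod_cast hN1
    have h1 : (N:ℝ) ≤ x ^ ε := Nat.floor_le (by linarith)
    have h2 := Real.log_le_log hN0 h1
    rw [Real.log_rpow hx0] at h2
    linarith
  have hM0 : 0 ≤ M := by
    apply Finset.sum_nonneg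
    intro p hp
    have := (Nat.mem_primesBelow.1 hp).2.one_le
    have : (1:ℝ) ≤ p := by exact_mod_cast this
    have := Real.log_nonneg this
    positivity
  have hm : M / Real.log z ≤ 96 * ε := by
    rw [div_le_iff₀ (by linarith)]
    nlinarith
  have hS := S_lower (N + 1) z hz4
  have htv := tv (GG f R τ) (GG_one _ _ _) (fun n => (GG_norm _ _ _ _).le)
    (fun m n _ _ h => GG_mul f R τ m n h) (N + 1) z hz4.le x (Real.exp (L / 2)) (192 * ε)
    (by linarith) (Real.one_lt_exp_iff.2 (by linarith)) (by linarith) (by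
      have h1 : 1 - 96 * ε ≤ (∑ q ∈ (PP (N+1)).divisors.filter (· ≤ z), 1 / (Nat.totient q : ℝ)) * VV (N+1) := by
        linarith
      have h2 : (1 - 96 * ε) * (1 + 192 * ε) ≤
        (∑ q ∈ (PP (N+1)).divisors.filter (· ≤ z), 1 / (Nat.totient q : ℝ)) * VV (N+1) * (1 + 192 * ε) :=
        mul_le_mul_of_nonneg_right h1 (by linarith)
      nlinarith)
  refine htv.trans ?_
  rw [Real.log_exp]
  have e1 : 1 / x ≤ ε ^ 2 := by
    refine le_trans ?_ hinv
    apply one_div_le_one_div_of_le hL0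
    rw [hLdef]
    linarith [Real.log_le_sub_one_of_pos hx0]
  have e2 : Real.exp (L / 2) * (z:ℝ)^6 / x ≤ 4 * ε ^ 2 := by
    have h1 : (z:ℝ)^6 ≤ Real.exp (L / 4) := by
      calc (z:ℝ)^6 ≤ (Real.exp (L / 24))^6 := by gcongr
        _ = Real.exp (L / 4) := by rw [← Real.exp_nat_mul]; congr 1; push_cast; ring
    have h2 : L / 4 ≤ Real.exp (L / 4) := by linarith [Real.add_one_le_exp (L / 4)]
    calc Real.exp (L / 2) * (z:ℝ)^6 / x ≤ Real.exp (L / 2) * Real.exp (L / 4) / x := by gcongr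
      _ = 1 / Real.exp (L / 4) := by
        rw [← Real.exp_add, hxe, ← Real.exp_sub, one_div, ← Real.exp_neg]
        congr 1
        rw [Real.log_exp] at *
        ring
      _ ≤ 1 / (L / 4) := one_div_le_one_div_of_le (by linarith) h2
      _ = 4 * (1 / L) := by field_simp
      _ ≤ _ := by linarith
  have e3 : 2 * M / (L / 2) ≤ 8 * ε := by
    rw [div_le_iff₀ (by linarith)]
    nlinarith
  linarith

set_option maxHeartbeats 1600000 in
theorem final_bound (C : ℝ) (hC : 0 < C) (f : ℕ → ℝ) (η : ℝ → ℝ) (hf : EWConv f) (hη : EtaBound f η)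
    (R T x ε τ : ℝ) (hR : 3 ≤ R) (hT : 3 ≤ T) (hx : 3 ≤ x)
    (h1 : 1 / Real.sqrt (Real.log x) < ε)
    (h2 : 2 * Real.log (Real.log R) + T^2 * η R / 2 + 7 ≤ Real.log (1/ε) / 4)
    (h3 : T^2 * η (x ^ ε) ≤ C * ε ^ ((1:ℝ)/3)) (hτ : |τ| ≤ T) (φτ : ℂ)
    (hφ : Tendsto (fun N : ℕ => ∏ p ∈ (Finset.range N).filter Nat.Prime, kap f R τ p)
      atTop (𝓝 φτ)) :
    ‖((x)⁻¹ : ℝ) * (∑ n ∈ Finset.Icc 1 ⌊x⌋₊, GG f R τ n) - φτ‖ ≤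
      (Real.sqrt (6 * C + 8 * C ^ 2) + 5 * C + 418) * ε ^ ((1:ℝ)/6) := by
  have hx0 : 0 < x := by linarith
  have hL0 : 0 < Real.log x := Real.log_pos (by linarith)
  have hε0 : 0 < ε := lt_trans (by positivity) h1
  have hL : 1 ≤ ε ^ 2 * Real.log x := by
    have hs : 0 < Real.sqrt (Real.log x) := Real.sqrt_pos.2 hL0
    rw [div_lt_iff₀ hs] at h1
    have h4 : 1 ≤ (ε * Real.sqrt (Real.log x)) ^ 2 := one_le_pow₀ h1.le
    rwa [mul_pow, Real.sq_sqrt hL0.le] at h4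
  have hlogR : 1 ≤ Real.log R := by
    rw [Real.le_log_iff_exp_le (by linarith)]
    linarith [Real.exp_one_lt_three]
  have hllR : 0 ≤ Real.log (Real.log R) := Real.log_nonneg hlogR
  have hηR := eta_nonneg hη R
  have hTη : 0 ≤ T ^ 2 * η R / 2 := by positivity
  have hb1 : 28 ≤ Real.log (1/ε) := by linarith
  have hb2 : Real.log (Real.log R) ≤ Real.log (1/ε) := by linarith
  have hεs : ε ≤ 1 / 400 := by
    have h4 : Real.exp 28 ≤ 1 / ε := (Real.le_log_iff_exp_le (by positivity)).1 hb1
    have h5 : (8:ℝ) ≤ Real.exp 7 := by linarith [Real.add_one_le_exp (7:ℝ)]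
    have h6 : Real.exp 28 = Real.exp 7 ^ 4 := by
      rw [← Real.exp_nat_mul]; norm_num
    have h7 : (8:ℝ)^4 ≤ Real.exp 7 ^ 4 := by gcongr
    have h8 : 400 ≤ 1 / ε := by rw [h6] at h4; linarith
    rw [le_div_iff₀ hε0] at h8
    linarith
  have hlR : Real.log R ≤ 1 / ε := (Real.log_le_log_iff (by linarith) (by positivity)).1 hb2
  set y := x ^ ε with hy
  have hye : Real.exp (1 / ε) ≤ y := by
    rw [hy, Real.rpow_def_of_pos hx0, Real.exp_le_exp, div_le_iff₀ hε0]
    linarith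
  have hRy : R ≤ y := by
    refine le_trans ?_ hye
    exact (Real.log_le_iff_le_exp (by linarith)).1 hlR
  have hy1 : 1 ≤ y := by linarith
  set K := ⌊y⌋₊ + 1 with hKd
  have hyK : y < K := by
    have := Nat.lt_floor_add_one y
    rw [hKd]; push_cast; exact this
  have hK : ∀ p : ℕ, K ≤ p ↔ y < p := by
    intro p
    rw [hKd, Nat.succ_le_iff, Nat.floor_lt (by linarith)]
  have hK1 : 1 ≤ K := by lia
  have hRK : R < K := by linarith
  have hKε : 1 / (K:ℝ) ≤ ε := by
    have h4 : 1 / ε ≤ K := by linarith [Real.add_one_le_exp (1 / ε)]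
    rw [div_le_iff₀ hε0] at h4
    rw [div_le_iff₀ (by linarith)]
    linarith
  have s1 := step1 f η hf hη R T τ y K ⌊x⌋₊ hy1 hK hRK hK1 hτ
  have s2 := step2 f R τ x ε hx hε0 hεs hL
  have s3 := step3 f η hf hη R T τ y K hy1 hK hRK hK1 hτ φτ hφ
  set N := ⌊x⌋₊ with hN
  have hη0 := eta_nonneg hη y
  set h := T ^ 2 * η y with hh
  have hh0 : 0 ≤ h := by positivity
  -- first part
  have t1 : ‖((x)⁻¹ : ℝ) * (∑ n ∈ Finset.Icc 1 N, GG f R τ n) -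
      ((x)⁻¹ : ℝ) * (∑ n ∈ Finset.Icc 1 N, GG f R τ (sp K n))‖ ≤
      4 / K + T * Real.sqrt (6 * η y + 8 * η y ^ 2) := by
    rw [← mul_sub, ← Finset.sum_sub_distrib, norm_mul, Complex.norm_real,
      Real.norm_of_nonneg (by positivity)]
    set Z := 4 / (K:ℝ) + T * Real.sqrt (6 * η y + 8 * η y ^ 2) with hZ
    have hZ0 : 0 ≤ Z := by positivity
    have hNx : (N:ℝ) ≤ x := Nat.floor_le hx0.le
    calc x⁻¹ * ‖∑ n ∈ Finset.Icc 1 N, (GG f R τ n - GG f R τ (sp K n))‖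
        ≤ x⁻¹ * (N * Z) := by
          apply mul_le_mul_of_nonneg_left _ (by positivity)
          exact (norm_sum_le _ _).trans s1
      _ ≤ x⁻¹ * (x * Z) := by gcongr
      _ = Z := by field_simp
  have hε1 : ε ≤ 1 := by linarith
  set a := ε ^ ((1:ℝ)/6) with ha
  have ha0 : 0 < a := Real.rpow_pos_of_pos hε0 _
  have ha1 : a ≤ 1 := Real.rpow_le_one hε0.le hε1 (by norm_num)
  have ha2 : ε ^ ((1:ℝ)/3) = a ^ 2 := by
    rw [ha, ← Real.rpow_natCast, ← Real.rpow_mul hε0.le]; norm_num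
  have ha6 : ε ≤ a := by
    have : ε = a ^ 6 := by
      rw [ha, ← Real.rpow_natCast, ← Real.rpow_mul hε0.le]; norm_num
    calc ε = a ^ 6 := this
      _ ≤ a ^ 1 := pow_le_pow_of_le_one ha0.le ha1 (by norm_num)
      _ = a := pow_one a
  rw [ha2] at h3
  have ha22 : a ^ 2 ≤ a := by nlinarith
  have hCa : h ≤ C * a := h3.trans (by gcongr)
  have t2 : T * Real.sqrt (6 * η y + 8 * η y ^ 2) ≤ Real.sqrt (6 * C + 8 * C ^ 2) * a := by
    have hT0 : 0 ≤ T := by linarith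
    have e1 : T * Real.sqrt (6 * η y + 8 * η y ^ 2) =
        Real.sqrt (T ^ 2 * (6 * η y + 8 * η y ^ 2)) := by
      rw [Real.sqrt_mul (by positivity), Real.sqrt_sq hT0]
    have e2 : Real.sqrt (6 * C + 8 * C ^ 2) * a = Real.sqrt ((6 * C + 8 * C ^ 2) * a ^ 2) := by
      rw [Real.sqrt_mul (by positivity), Real.sqrt_sq ha0.le]
    rw [e1, e2]
    apply Real.sqrt_le_sqrt
    have e3 : T ^ 2 * η y ^ 2 ≤ h ^ 2 := by
      have : h ^ 2 = T ^ 2 * (T ^ 2 * η y ^ 2) := by rw [hh]; ring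
      rw [this]
      have hT1 : 1 ≤ T ^ 2 := one_le_pow₀ (by linarith)
      exact le_mul_of_one_le_left (by positivity) hT1
    have e4 : h ^ 2 ≤ C ^ 2 * a ^ 2 := by
      calc h ^ 2 ≤ (C * a) ^ 2 := by gcongr
        _ = _ := by ring
    calc T ^ 2 * (6 * η y + 8 * η y ^ 2) = 6 * h + 8 * (T ^ 2 * η y ^ 2) := by rw [hh]; ring
      _ ≤ _ := by linarith
  have t3 : 2 * T * η y ≤ h := by
    rw [hh]
    apply mul_le_mul_of_nonneg_right _ hη0
    nlinarith
  have t4 : 4 / (K:ℝ) ≤ 4 * ε := by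
    calc 4 / (K:ℝ) = 4 * (1 / (K:ℝ)) := by ring
      _ ≤ _ := by linarith
  have n1 := norm_sub_le_norm_sub_add_norm_sub
    (((x)⁻¹ : ℝ) * (∑ n ∈ Finset.Icc 1 N, GG f R τ n))
    (((x)⁻¹ : ℝ) * (∑ n ∈ Finset.Icc 1 N, GG f R τ (sp K n))) φτ
  have n2 := norm_sub_le_norm_sub_add_norm_sub
    (((x)⁻¹ : ℝ) * (∑ n ∈ Finset.Icc 1 N, GG f R τ (sp K n)))
    (∏ p ∈ K.primesBelow, kap f R τ p) φτ
  have t5 : 4 * T ^ 2 * η y = 4 * h := by rw [hh]; ring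
  linarith

/-- Estimate (4.7): for every `C > 0` there is `C'` such that, under the stated
conditions on `R, T, x, ε`, one has `|φ_x(τ; R) − φ(τ; R)| ≤ C' ε^{1/6}` for `|τ| ≤ T`. -/
theorem char_fun_asymptotic (C : ℝ) (hC : 0 < C) :
    ∃ C' : ℝ, 0 < C' ∧
      ∀ (f : ℕ → ℝ) (η : ℝ → ℝ), IsAdditive f → EWConv f → EtaBound f η →
        ∀ R T x ε τ : ℝ, 3 ≤ R → 3 ≤ T → 3 ≤ x →
          1 / Real.sqrt (Real.log x) < ε → ε ≤ 1/2 →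
          2 * Real.log (Real.log R) + T^2 * η R / 2 + 7 ≤ Real.log (1/ε) / 4 →
          T^2 * η (x ^ ε) ≤ C * ε ^ ((1:ℝ)/3) →
          |τ| ≤ T →
          ∀ φτ : ℂ,
            -- φτ = φ(τ; R), the value of the (ordered) Euler product
            Tendsto (fun N : ℕ =>
                ∏ p ∈ (Finset.range N).filter Nat.Prime,
                  ((1 - 1/(p:ℂ)) * ∑' ν : ℕ,
                    Complex.exp ((τ * fR f R (p ^ ν) : ℝ) * Complex.I) / (p : ℂ) ^ ν))
              atTop (𝓝 φτ) →
            ‖((x)⁻¹ : ℝ) * (∑ n ∈ Finset.Icc 1 ⌊x⌋₊,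
                Complex.exp ((τ * fR f R n : ℝ) * Complex.I)) - φτ‖ ≤
              C' * ε ^ ((1:ℝ)/6) := by
  refine ⟨Real.sqrt (6 * C + 8 * C ^ 2) + 5 * C + 418, by positivity, ?_⟩
  intro f η _ hf hη R T x ε τ hR hT hx h1 _ h2 h3 hτ φτ hφ
  exact final_bound C hC f η hf hη R T x ε τ hR hT hx h1 h2 h3 hτ φτ hφ

end
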